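/- arXiv:2502.18820 — 3 statements merged into one kernel-verified Lean document; each statement's English description precedes it below -/
import Mathlib

section
/- Let ν be a measure on ℝ with ν({0}) = 0 and ∫ (x²∧1) ν(dx) < ∞, admitting a density ξ with ξ(±x) ~ x^{-α-1} K_±(x) as x → 0+ for α ∈ (1,2) and K_± slowly varying at 0. Assume k := lim_{x→0+} K_-(x)/K_+(x) exists in [0,∞]. Then θ(λ) := ∫ℝ (1 - cos λx) ν(dx) satisfies θ(λ)/(λ^α (K_+(1/λ)+K_-(1/λ))) → π C_{α+1} as λ → ∞, where C_{α+1} = (1/π)∫₀^∞ (1-cos x)/x^{α+1} dx. -/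
open MeasureTheory Set Filter Topology Real

/-- `L` is slowly varying at `0+`: measurable, eventually positive near `0+`,
and `L(c x)/L(x) → 1` as `x → 0+` for every `c > 0`. -/
def SlowlyVaryingAtZero (L : ℝ → ℝ) : Prop :=
  Measurable L ∧ (∀ᶠ x in 𝓝[>] (0:ℝ), 0 < L x) ∧
    ∀ c : ℝ, 0 < c →
      Tendsto (fun x : ℝ => L (c * x) / L x) (𝓝[>] (0:ℝ)) (𝓝 1)


lemma uct_aux (h : ℝ → ℝ) (hm : Measurable h)
    (hs : ∀ u : ℝ, Tendsto (fun x => h (x + u) - h x) atTop (𝓝 0)) (η : ℝ) (hη : 0 < η) :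
    ∃ X : ℝ, ∀ x, X ≤ x → ∀ u, 0 ≤ u → u ≤ 1 → |h (x + u) - h x| ≤ η := by
  let φ : ℝ → ℝ := fun t => min 1 |t|
  have φm : Measurable φ := by fun_prop
  have φ0 : ∀ t, 0 ≤ φ t := fun t => le_min zero_le_one (abs_nonneg t)
  have φ1 : ∀ t, φ t ≤ 1 := fun t => min_le_left _ _
  let F : ℝ → ℝ := fun y => ∫ v in Icc (0:ℝ) 2, φ (h (y + v) - h y)
  have Fi : ∀ y (s : Set ℝ), volume s < ⊤ → IntegrableOn (fun v => φ (h (y + v) - h y)) s := by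
    intro y s hsf
    refine Measure.integrableOn_of_bounded (M := 1) hsf.ne ?_ ?_
    · exact (φm.comp ((hm.comp (measurable_const_add y)).sub_const _)).aestronglyMeasurable
    · refine Eventually.of_forall fun v => ?_
      rw [Real.norm_eq_abs, abs_of_nonneg (φ0 _)]; exact φ1 _
  have hF : Tendsto F atTop (𝓝 0) := by
    have : Tendsto F atTop (𝓝 (∫ v in Icc (0:ℝ) 2, (0:ℝ))) := by
      refine tendsto_integral_filter_of_dominated_convergence (fun _ => (1:ℝ)) ?_ ?_ ?_ ?_
      · refine Eventually.of_forall fun y => ?_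
        exact (φm.comp ((hm.comp (measurable_const_add y)).sub_const _)).aestronglyMeasurable
      · refine Eventually.of_forall fun y => Eventually.of_forall fun v => ?_
        rw [Real.norm_eq_abs, abs_of_nonneg (φ0 _)]; exact φ1 _
      · exact integrable_const _
      · refine Eventually.of_forall fun v => ?_
        have hc : Continuous φ := by fun_prop
        have := (hc.tendsto 0).comp (hs v)
        simpa [φ, Function.comp_def] using this
    simpa using this
  have key : ∀ x u, 0 ≤ u → u ≤ 1 → φ (h (x + u) - h x) ≤ F (x + u) + F x := by
    intro x u hu0 hu1
    have tri : ∀ a b, φ (a - b) ≤ φ a + φ b := by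
      intro a b
      have := abs_sub a b
      have ha := abs_nonneg a
      have hb := abs_nonneg b
      simp only [φ]
      rcases le_total 1 |a| with h1 | h1 <;> rcases le_total 1 |b| with h2 | h2 <;>
        simp only [min_eq_left h1, min_eq_right h1, min_eq_left h2, min_eq_right h2] <;>
        first
          | (refine (min_le_left _ _).trans ?_; linarith)
          | (refine (min_le_right _ _).trans ?_; linarith)
    have e1 : φ (h (x + u) - h x) = ∫ v in Icc (1:ℝ) 2, φ (h (x + u) - h x) := by
      simp; norm_num
    have e2 : ∫ v in Icc (1:ℝ) 2, φ (h (x + v) - h x) ≤ F x :=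
      setIntegral_mono_set (Fi x _ (by simp)) (Eventually.of_forall fun v => φ0 _)
        (Eventually.of_forall (Icc_subset_Icc_left zero_le_one))
    have e3 : ∫ v in Icc (1:ℝ) 2, φ (h (x + v) - h (x + u)) ≤ F (x + u) := by
      have : ∫ v in Icc (1:ℝ) 2, φ (h (x + v) - h (x + u))
          = ∫ v in Icc (1 - u) (2 - u), φ (h (x + u + v) - h (x + u)) := by
        rw [integral_Icc_eq_integral_Ioc, integral_Icc_eq_integral_Ioc,
          ← intervalIntegral.integral_of_le (by norm_num),
          ← intervalIntegral.integral_of_le (by linarith),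
          ← intervalIntegral.integral_comp_sub_right
            (fun v => φ (h (x + u + v) - h (x + u))) u]
        congr 1; ext v; congr 3; ring
      rw [this]
      exact setIntegral_mono_set (Fi (x + u) _ (by simp)) (Eventually.of_forall fun v => φ0 _)
        (Eventually.of_forall (Icc_subset_Icc (by linarith) (by linarith)))
    have i2 := Fi x (Icc 1 2) (by simp)
    have i3 : IntegrableOn (fun v => φ (h (x + v) - h (x + u))) (Icc 1 2) := by
      refine Measure.integrableOn_of_bounded (M := 1) (by simp) ?_ ?_
      · exact (φm.comp ((hm.comp (measurable_const_add x)).sub_const _)).aestronglyMeasurable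
      · refine Eventually.of_forall fun v => ?_
        rw [Real.norm_eq_abs, abs_of_nonneg (φ0 _)]; exact φ1 _
    rw [e1]
    calc _ ≤ ∫ v in Icc (1:ℝ) 2, (φ (h (x + v) - h x) + φ (h (x + v) - h (x + u))) := by
          refine integral_mono (by simp) (i2.add i3) fun v => ?_
          have := tri (h (x + v) - h x) (h (x + v) - h (x + u))
          simpa using this
      _ = _ := integral_add i2 i3
      _ ≤ _ := by linarith
  have hpos : 0 < min (1/2) η := by positivity
  obtain ⟨X, hX⟩ := eventually_atTop.1 (hF.eventually (gt_mem_nhds (half_pos hpos)))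
  refine ⟨X, fun x hx u h0 h1 => ?_⟩
  have a1 := hX x hx
  have a2 := hX (x + u) (by linarith)
  have a3 := key x u h0 h1
  have a4 : φ (h (x + u) - h x) < min (1/2) η := by linarith
  have a5 : φ (h (x + u) - h x) < 1/2 := a4.trans_le (min_le_left _ _)
  have a6 : φ (h (x + u) - h x) < η := a4.trans_le (min_le_right _ _)
  simp only [φ] at a5 a6
  rcases le_total 1 |h (x + u) - h x| with h1 | h1
  · rw [min_eq_left h1] at a5; norm_num at a5
  · rw [min_eq_right h1] at a6; exact a6.le

lemma potter_add (h : ℝ → ℝ) (hm : Measurable h)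
    (hs : ∀ u : ℝ, Tendsto (fun x => h (x + u) - h x) atTop (𝓝 0)) (η : ℝ) (hη : 0 < η) :
    ∃ X : ℝ, ∀ x, X ≤ x → ∀ t, 0 ≤ t → |h (x + t) - h x| ≤ η * (t + 1) := by
  obtain ⟨X, hX⟩ := uct_aux h hm hs η hη
  refine ⟨X, ?_⟩
  have hn : ∀ n : ℕ, ∀ x, X ≤ x → |h (x + n) - h x| ≤ η * n := by
    intro n
    induction n with
    | zero => intro x _; simp
    | succ n ih =>
      intro x hx
      have h1 := ih x hx
      have h2 := hX (x + n) (by have : (0:ℝ) ≤ n := n.cast_nonneg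
                                linarith) 1 zero_le_one le_rfl
      push_cast
      rw [← add_assoc]
      have := abs_sub_le (h (x + n + 1)) (h (x + n)) (h x)
      linarith
  intro x hx t ht
  have h1 := hn ⌊t⌋₊ x hx
  have hf := Nat.floor_le ht
  have h2 := hX (x + ⌊t⌋₊) (by have : (0:ℝ) ≤ ⌊t⌋₊ := Nat.cast_nonneg _
                               linarith) (t - ⌊t⌋₊) (by linarith)
    (by have := Nat.lt_floor_add_one t; linarith)
  rw [show x + ⌊t⌋₊ + (t - ⌊t⌋₊) = x + t by ring] at h2
  have := abs_sub_le (h (x + t)) (h (x + ⌊t⌋₊)) (h x)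
  nlinarith

lemma potter (K : ℝ → ℝ) (hK : SlowlyVaryingAtZero K) (η : ℝ) (hη : 0 < η) :
    ∃ δ : ℝ, 0 < δ ∧ (∀ x, 0 < x → x < δ → 0 < K x) ∧
      ∀ x y, 0 < x → x < δ → 0 < y → y < δ →
        K x / K y ≤ exp η * ((x / y) ^ η + (x / y) ^ (-η)) := by
  obtain ⟨hm, hp, hsv⟩ := hK
  have texp : Tendsto (fun t : ℝ => exp (-t)) atTop (𝓝[>] 0) :=
    tendsto_nhdsWithin_iff.2 ⟨tendsto_exp_neg_atTop_nhds_zero,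
      Eventually.of_forall fun t => exp_pos _⟩
  let h : ℝ → ℝ := fun t => log (K (exp (-t)))
  have hhm : Measurable h := by
    exact Real.measurable_log.comp (hm.comp (by fun_prop))
  have hs : ∀ u : ℝ, Tendsto (fun x => h (x + u) - h x) atTop (𝓝 0) := by
    intro u
    have h1 := (hsv (exp (-u)) (exp_pos _)).comp texp
    have h2 := (continuousAt_log one_ne_zero).tendsto.comp h1
    rw [log_one] at h2
    refine h2.congr' ?_
    have p1 := texp.eventually hp
    have p2 := (texp.comp (tendsto_atTop_add_const_right atTop u tendsto_id)).eventually hp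
    filter_upwards [p1, p2] with x p1 p2
    simp only [Function.comp_apply, id] at p2 ⊢
    have e : exp (-u) * exp (-x) = exp (-(x + u)) := by rw [← exp_add]; congr 1; ring
    rw [e, log_div p2.ne' p1.ne']
  obtain ⟨X, hX⟩ := potter_add h hhm hs η hη
  obtain ⟨d, hd, hdp⟩ := mem_nhdsGT_iff_exists_Ioo_subset.1 hp
  have hpos : ∀ x, 0 < x → x < min d (exp (-X)) → 0 < K x := fun x h0 h1 =>
    hdp ⟨h0, h1.trans_le (min_le_left _ _)⟩
  refine ⟨min d (exp (-X)), lt_min hd (exp_pos _), hpos, ?_⟩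
  intro x y hx0 hx hy0 hy
  have kx := hpos x hx0 hx
  have ky := hpos y hy0 hy
  have hlx : X ≤ -log x := by
    have := (log_lt_log hx0 (hx.trans_le (min_le_right _ _))); rw [log_exp] at this; linarith
  have hly : X ≤ -log y := by
    have := (log_lt_log hy0 (hy.trans_le (min_le_right _ _))); rw [log_exp] at this; linarith
  have ex : h (-log x) = log (K x) := by simp [h, exp_log hx0]
  have ey : h (-log y) = log (K y) := by simp [h, exp_log hy0]
  have hxy : 0 < x / y := div_pos hx0 hy0
  have e : K x / K y = exp (log (K x) - log (K y)) := by
    rw [exp_sub, exp_log kx, exp_log ky]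
  rw [e, rpow_def_of_pos hxy, rpow_def_of_pos hxy, log_div hx0.ne' hy0.ne', mul_add,
    ← exp_add, ← exp_add]
  rcases le_total (log x) (log y) with hle | hle
  · have := hX _ hly (log y - log x) (by linarith)
    rw [show -log y + (log y - log x) = -log x by ring, ex, ey] at this
    have := (le_abs_self _).trans this
    have h1 : exp (log (K x) - log (K y)) ≤ exp (η + (log x - log y) * -η) :=
      exp_le_exp.2 (by linarith)
    have := exp_pos (η + (log x - log y) * η)
    linarith
  · have := hX _ hlx (log x - log y) (by linarith)
    rw [show -log x + (log x - log y) = -log y by ring, ex, ey] at this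
    have := (neg_le_abs _).trans this
    have h1 : exp (log (K x) - log (K y)) ≤ exp (η + (log x - log y) * η) :=
      exp_le_exp.2 (by linarith)
    have := exp_pos (η + (log x - log y) * -η)
    linarith

lemma integrable_cos_rpow (s : ℝ) (h0 : 0 < s) (h2 : s < 2) :
    IntegrableOn (fun u : ℝ => (1 - cos u) * u ^ (-s - 1)) (Ioi 0) := by
  have hm : Measurable (fun u : ℝ => (1 - cos u) * u ^ (-s - 1)) := by fun_prop
  rw [← Ioc_union_Ioi_eq_Ioi (zero_le_one (α := ℝ))]
  refine IntegrableOn.union ?_ ?_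
  · have : IntegrableOn (fun u : ℝ => u ^ (1 - s)) (Ioc 0 1) :=
      (intervalIntegrable_iff_integrableOn_Ioc_of_le zero_le_one).1
        (intervalIntegral.intervalIntegrable_rpow' (by linarith))
    refine Integrable.mono' this hm.aestronglyMeasurable ?_
    filter_upwards [ae_restrict_mem measurableSet_Ioc] with u hu
    have c1 := cos_le_one u
    have c2 := one_sub_sq_div_two_le_cos (x := u)
    have hp := rpow_pos_of_pos hu.1 (-s - 1)
    rw [Real.norm_eq_abs, abs_of_nonneg (by apply mul_nonneg <;> linarith)]
    rw [show (1 - s) = 2 + (-s - 1) by ring, rpow_add hu.1, rpow_two]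
    gcongr
    nlinarith [sq_nonneg u]
  · have := (integrableOn_Ioi_rpow_of_lt (a := -s - 1) (by linarith) (zero_lt_one (α := ℝ))).const_mul 2
    refine Integrable.mono' this hm.aestronglyMeasurable ?_
    filter_upwards [ae_restrict_mem measurableSet_Ioi] with u hu
    have hu0 : 0 < u := zero_lt_one.trans hu
    have c1 := cos_le_one u
    have c2 := neg_one_le_cos u
    have hp := rpow_pos_of_pos hu0 (-s - 1)
    rw [Real.norm_eq_abs, abs_of_nonneg (by apply mul_nonneg <;> linarith)]
    gcongr
    linarith

lemma tendsto_inv_norm (α : ℝ) (hα : 0 < α) (K : ℝ → ℝ) (hK : SlowlyVaryingAtZero K) :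
    Tendsto (fun l : ℝ => 1 / (l ^ α * K (1 / l))) atTop (𝓝 0) := by
  obtain ⟨δ, hδ, hp, hb⟩ := potter K hK (α / 2) (by positivity)
  set y := δ / 2 with hy
  have hy0 : 0 < y := by positivity
  have hyδ : y < δ := by linarith
  have ky := hp y hy0 hyδ
  have hlim : Tendsto (fun l : ℝ => (exp (α/2) * (y ^ (α/2) * l ^ (-(α/2))
      + y ^ (-(α/2)) * l ^ (-(3*α/2)))) / K y) atTop (𝓝 0) := by
    have t1 := tendsto_rpow_neg_atTop (y := α/2) (by positivity)
    have t2 := tendsto_rpow_neg_atTop (y := 3*α/2) (by positivity)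
    have := (((t1.const_mul (y ^ (α/2))).add (t2.const_mul (y ^ (-(α/2))))).const_mul
      (exp (α/2))).div_const (K y)
    simpa using this
  refine tendsto_of_tendsto_of_tendsto_of_le_of_le' tendsto_const_nhds hlim ?_ ?_
  · filter_upwards [eventually_gt_atTop (1/δ)] with l hl
    have hl0 : 0 < l := (by positivity : 0 < 1/δ).trans hl
    have hlδ : 1 / l < δ := by rw [one_div_lt hl0 hδ]; exact hl
    have := hp (1/l) (by positivity) hlδ
    positivity
  · filter_upwards [eventually_gt_atTop (1/δ)] with l hl
    have hl0 : 0 < l := (by positivity : 0 < 1/δ).trans hl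
    have hlδ : 1 / l < δ := by rw [one_div_lt hl0 hδ]; exact hl
    have kl := hp (1/l) (by positivity) hlδ
    have h1 := hb y (1/l) hy0 hyδ (by positivity) hlδ
    have e : y / (1 / l) = y * l := by field_simp
    rw [e, mul_rpow hy0.le hl0.le, mul_rpow hy0.le hl0.le] at h1
    have hla := rpow_pos_of_pos hl0 α
    have e1 : l ^ (-(α/2)) = l ^ (α/2) / l ^ α := by
      rw [← rpow_sub hl0]; congr 1; ring
    have e2 : l ^ (-(3*α/2)) = l ^ (-(α/2)) / l ^ α := by
      rw [← rpow_sub hl0]; congr 1; ring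
    have e3 : 1 / (l ^ α * K (1 / l)) = (K y / K (1/l)) / (l ^ α * K y) := by
      field_simp
    rw [e2, e1, e3]
    have e4 : exp (α / 2) * (y ^ (α / 2) * (l ^ (α / 2) / l ^ α) +
        y ^ (-(α / 2)) * (l ^ (α/2) / l ^ α / l ^ α)) / K y
       = (exp (α / 2) * (y ^ (α / 2) * l ^ (α / 2) +
        y ^ (-(α / 2)) * (l ^ (α/2) / l ^ α))) / (l ^ α * K y) := by
      field_simp
    rw [e4]
    rw [e1] at h1
    gcongr

lemma tendsto_J (α : ℝ) (h0 : 1 < α) (h2 : α < 2) (K : ℝ → ℝ) (hK : SlowlyVaryingAtZero K) :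
    ∃ δ₀ : ℝ, 0 < δ₀ ∧ (∀ x, 0 < x → x < δ₀ → 0 < K x) ∧ ∀ δ, 0 < δ → δ < δ₀ →
      Tendsto (fun l : ℝ => (∫ x in Ioo 0 δ, (x ^ (-α - 1) * K x) * (1 - cos (l * x)))
        / (l ^ α * K (1 / l))) atTop
        (𝓝 (∫ x in Set.Ioi (0:ℝ), (1 - Real.cos x) / x ^ (α + 1))) := by
  set η := (2 - α) / 2 with hη
  have hη0 : 0 < η := by rw [hη]; linarith
  obtain ⟨δ₀, hδ₀, hp, hb⟩ := potter K hK η hη0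
  refine ⟨δ₀, hδ₀, hp, fun δ hδ hδδ => ?_⟩
  let T : ℝ → ℝ → ℝ := fun l u =>
    (Iio (δ * l)).indicator (fun u => (1 - cos u) * u ^ (-α - 1) * (K (u / l) / K (1 / l))) u
  have hKm := hK.1
  have hT : ∀ᶠ l : ℝ in atTop, ∫ u in Ioi 0, T l u =
      (∫ x in Ioo 0 δ, (x ^ (-α - 1) * K x) * (1 - cos (l * x))) / (l ^ α * K (1 / l)) := by
    filter_upwards [eventually_gt_atTop (1/δ)] with l hl
    have hl0 : 0 < l := (by positivity : 0 < 1/δ).trans hl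
    have hlδ : 1 / l < δ := by rw [one_div_lt hl0 hδ]; exact hl
    have kl := hp (1/l) (by positivity) (hlδ.trans hδδ)
    let G : ℝ → ℝ := (Iio δ).indicator (fun x => (x ^ (-α - 1) * K x) * (1 - cos (l * x)))
    have e1 : ∫ x in Ioo 0 δ, (x ^ (-α - 1) * K x) * (1 - cos (l * x)) = ∫ x in Ioi 0, G x := by
      rw [setIntegral_indicator measurableSet_Iio, Ioi_inter_Iio]
    have e2 := integral_comp_mul_left_Ioi G 0 (inv_pos.2 hl0)
    rw [mul_zero, inv_inv, smul_eq_mul] at e2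
    have e3 : ∫ x in Ioi 0, G x = l⁻¹ * ∫ u in Ioi 0, G (l⁻¹ * u) := by
      rw [e2]; field_simp
    rw [e1, e3, div_eq_mul_inv, mul_comm, ← mul_assoc, ← integral_const_mul]
    refine setIntegral_congr_fun measurableSet_Ioi fun u hu => ?_
    have hu : 0 < u := hu
    simp only [T, G]
    have hiff : u < δ * l ↔ l⁻¹ * u < δ := by
      rw [inv_mul_lt_iff₀ hl0, mul_comm]
    by_cases hc : u < δ * l
    · rw [indicator_of_mem (show u ∈ Iio (δ * l) from hc),
        indicator_of_mem (show l⁻¹ * u ∈ Iio δ from hiff.1 hc)]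
      have e5 : l * (l⁻¹ * u) = u := by field_simp
      rw [e5, mul_rpow (by positivity) hu.le, inv_rpow hl0.le, ← rpow_neg hl0.le,
        show -(-α - 1) = α + 1 by ring, rpow_add hl0, rpow_one, div_eq_inv_mul u l]
      have := rpow_pos_of_pos hl0 α
      field_simp
    · rw [indicator_of_notMem (show u ∉ Iio (δ * l) from hc),
        indicator_of_notMem (show l⁻¹ * u ∉ Iio δ from fun h => hc (hiff.2 h))]
      simp
  refine Tendsto.congr' hT ?_
  have eC : ∫ x in Set.Ioi (0:ℝ), (1 - Real.cos x) / x ^ (α + 1)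
      = ∫ u in Ioi (0:ℝ), (1 - cos u) * u ^ (-α - 1) := by
    refine setIntegral_congr_fun measurableSet_Ioi fun u hu => ?_
    have hu : 0 < u := hu
    rw [show -α - 1 = -(α + 1) by ring, rpow_neg hu.le, div_eq_mul_inv]
  rw [eC]
  refine tendsto_integral_filter_of_dominated_convergence
    (fun u => exp η * ((1 - cos u) * u ^ (-(α - η) - 1) + (1 - cos u) * u ^ (-(α + η) - 1)))
    ?_ ?_ ?_ ?_
  · refine Eventually.of_forall fun l => Measurable.aestronglyMeasurable ?_
    refine Measurable.indicator ?_ measurableSet_Iio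
    have : Measurable fun u => K (u / l) := hKm.comp (measurable_id.div_const l)
    fun_prop
  · filter_upwards [eventually_gt_atTop (1/δ)] with l hl
    have hl0 : 0 < l := (by positivity : 0 < 1/δ).trans hl
    have hlδ : 1 / l < δ := by rw [one_div_lt hl0 hδ]; exact hl
    have kl := hp (1/l) (by positivity) (hlδ.trans hδδ)
    filter_upwards [ae_restrict_mem measurableSet_Ioi] with u hu
    have hu : 0 < u := hu
    have c1 : 0 ≤ 1 - cos u := by linarith [cos_le_one u]
    simp only [T]
    by_cases hc : u < δ * l
    · rw [indicator_of_mem (show u ∈ Iio (δ * l) from hc)]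
      have hul : u / l < δ := by rwa [div_lt_iff₀ hl0]
      have ku := hp (u/l) (by positivity) (hul.trans hδδ)
      have h1 := hb (u/l) (1/l) (by positivity) (hul.trans hδδ) (by positivity) (hlδ.trans hδδ)
      rw [show u / l / (1 / l) = u by field_simp] at h1
      rw [Real.norm_eq_abs, abs_of_nonneg (by positivity)]
      calc _ ≤ (1 - cos u) * u ^ (-α - 1) * (exp η * (u ^ η + u ^ (-η))) := by gcongr
        _ = _ := by
          rw [show -(α - η) - 1 = (-α - 1) + η by ring, show -(α + η) - 1 = (-α - 1) + -η by ring,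
            rpow_add hu, rpow_add hu (-α - 1) (-η)]
          ring
    · rw [indicator_of_notMem (show u ∉ Iio (δ * l) from hc), norm_zero]
      positivity
  · exact ((integrable_cos_rpow (α - η) (by rw [hη]; linarith) (by linarith)).add
      (integrable_cos_rpow (α + η) (by linarith) (by rw [hη]; linarith))).const_mul _
  · filter_upwards [ae_restrict_mem measurableSet_Ioi] with u hu
    have hu : 0 < u := hu
    have tl : Tendsto (fun l : ℝ => 1 / l) atTop (𝓝[>] 0) := by
      simpa using tendsto_inv_atTop_nhdsGT_zero (𝕜 := ℝ)
    have h1 := ((hK.2.2 u hu).comp tl).const_mul ((1 - cos u) * u ^ (-α - 1))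
    rw [mul_one] at h1
    refine h1.congr' ?_
    filter_upwards [eventually_gt_atTop (u/δ)] with l hl
    have : u < δ * l := by rwa [div_lt_iff₀' hδ] at hl
    simp only [T]
    rw [indicator_of_mem (show u ∈ Iio (δ * l) from this)]
    simp [div_eq_mul_inv]

lemma integrable_one_sub_cos (ν : Measure ℝ)
    (hνint : ∫⁻ x, ENNReal.ofReal (min (x ^ 2) 1) ∂ν < ⊤) (l : ℝ) :
    Integrable (fun x => 1 - cos (l * x)) ν := by
  have hi : Integrable (fun x : ℝ => min (x ^ 2) 1) ν := by
    refine ⟨by fun_prop, ?_⟩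
    rw [hasFiniteIntegral_iff_ofReal (Eventually.of_forall fun x => by positivity)]
    exact hνint
  refine (hi.const_mul (2 + l ^ 2)).mono' (by fun_prop) (Eventually.of_forall fun x => ?_)
  have c1 := cos_le_one (l * x)
  have c2 := one_sub_sq_div_two_le_cos (x := l * x)
  have c3 := neg_one_le_cos (l * x)
  rw [Real.norm_eq_abs, abs_of_nonneg (by linarith)]
  rcases le_total (x ^ 2) 1 with h | h
  · rw [min_eq_left h]; nlinarith [sq_nonneg x, sq_nonneg (l * x)]
  · rw [min_eq_right h]; nlinarith [sq_nonneg l]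

lemma measure_Ici_lt_top (ν : Measure ℝ)
    (hνint : ∫⁻ x, ENNReal.ofReal (min (x ^ 2) 1) ∂ν < ⊤) (δ : ℝ) (hδ : 0 < δ) :
    ν (Ici δ) < ⊤ := by
  have hc : 0 < min (δ ^ 2) 1 := by positivity
  refine lt_of_le_of_lt (measure_mono ?_) (meas_ge_le_lintegral_div (μ := ν)
    (f := fun x => ENNReal.ofReal (min (x ^ 2) 1)) (by fun_prop)
    (ε := ENNReal.ofReal (min (δ ^ 2) 1)) (ENNReal.ofReal_pos.2 hc).ne' (by simp) |>.trans_lt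
      (ENNReal.div_lt_top hνint.ne (ENNReal.ofReal_pos.2 hc).ne'))
  intro x hx
  have hx : δ ≤ x := hx
  simp only [mem_ofPred_eq]
  gcongr

lemma one_sided (ν : Measure ℝ)
    (hνint : ∫⁻ x, ENNReal.ofReal (min (x ^ 2) 1) ∂ν < ⊤)
    (ξ : ℝ → ℝ) (hξ : ν = MeasureTheory.volume.withDensity (fun x => ENNReal.ofReal (ξ x)))
    (α : ℝ) (h0 : 1 < α) (h2 : α < 2)
    (K : ℝ → ℝ) (hK : SlowlyVaryingAtZero K)
    (hξp : Tendsto (fun x : ℝ => ξ x / (x ^ (-α - 1) * K x)) (𝓝[>] (0:ℝ)) (𝓝 1)) :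
    Tendsto (fun l : ℝ => (∫ x in Ioi 0, (1 - Real.cos (l * x)) ∂ν) / (l ^ α * K (1 / l))) atTop
      (𝓝 (∫ x in Set.Ioi (0:ℝ), (1 - Real.cos x) / x ^ (α + 1))) := by
  set C := ∫ x in Set.Ioi (0:ℝ), (1 - Real.cos x) / x ^ (α + 1) with hC
  obtain ⟨δ₀, hδ₀, hp, hJ⟩ := tendsto_J α h0 h2 K hK
  have hN := tendsto_inv_norm α (by linarith) K hK
  have hKm := hK.1
  have hint := integrable_one_sub_cos ν hνint
  have hg0 : ∀ l x : ℝ, 0 ≤ 1 - cos (l * x) := fun l x => by linarith [cos_le_one (l * x)]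
  have main : ∀ ε : ℝ, 0 < ε → ε < 1 → ∃ δ, 0 < δ ∧ δ < δ₀ ∧ ∀ l : ℝ,
      (1 - ε) * (∫ x in Ioo 0 δ, (x ^ (-α - 1) * K x) * (1 - cos (l * x)))
        ≤ ∫ x in Ioo 0 δ, (1 - cos (l * x)) ∂ν ∧
      ∫ x in Ioo 0 δ, (1 - cos (l * x)) ∂ν ≤
      (1 + ε) * (∫ x in Ioo 0 δ, (x ^ (-α - 1) * K x) * (1 - cos (l * x))) := by
    intro ε hε hε1
    have ev := hξp.eventually (Ioo_mem_nhds (show 1 - ε < 1 by linarith)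
      (show 1 < 1 + ε by linarith))
    obtain ⟨d, hd, hdp⟩ := mem_nhdsGT_iff_exists_Ioo_subset.1 ev
    have hd : 0 < d := hd
    refine ⟨min d (δ₀ / 2), by positivity, (min_le_right _ _).trans_lt (by linarith), ?_⟩
    set δ := min d (δ₀ / 2) with hδ
    intro l
    set H : ℝ → ℝ := fun x => x ^ (-α - 1) * K x with hH
    have hHm : Measurable H := by fun_prop
    have hHpos : ∀ x ∈ Ioo 0 δ, 0 < H x := fun x hx =>
      mul_pos (rpow_pos_of_pos hx.1 _)
        (hp x hx.1 (hx.2.trans_le ((min_le_right _ _).trans (by linarith))))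
    have hbd : ∀ x ∈ Ioo 0 δ, (1 - ε) * H x ≤ ξ x ∧ ξ x ≤ (1 + ε) * H x := by
      intro x hx
      have h1 := hdp (show x ∈ Ioo 0 d from ⟨hx.1, hx.2.trans_le (min_le_left _ _)⟩)
      have h3 := hHpos x hx
      have h1 : 1 - ε < ξ x / H x ∧ ξ x / H x < 1 + ε := h1
      rw [lt_div_iff₀ h3, div_lt_iff₀ h3] at h1
      exact ⟨h1.1.le, h1.2.le⟩
    let μ : ℝ → Measure ℝ := fun c =>
      (volume.restrict (Ioo 0 δ)).withDensity (fun x => ENNReal.ofReal (c * H x))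
    have hνr : ν.restrict (Ioo 0 δ) =
        (volume.restrict (Ioo 0 δ)).withDensity (fun x => ENNReal.ofReal (ξ x)) := by
      rw [hξ, restrict_withDensity measurableSet_Ioo]
    have hlow : μ (1 - ε) ≤ ν.restrict (Ioo 0 δ) := by
      rw [hνr]
      refine withDensity_mono ?_
      filter_upwards [ae_restrict_mem measurableSet_Ioo] with x hx
      exact ENNReal.ofReal_le_ofReal (hbd x hx).1
    have hup : ν.restrict (Ioo 0 δ) ≤ μ (1 + ε) := by
      rw [hνr]
      refine withDensity_mono ?_
      filter_upwards [ae_restrict_mem measurableSet_Ioo] with x hx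
      exact ENNReal.ofReal_le_ofReal (hbd x hx).2
    have hμint : ∀ c, 0 < c → ∫ x, (1 - cos (l * x)) ∂(μ c) =
        c * ∫ x in Ioo 0 δ, H x * (1 - cos (l * x)) := by
      intro c hc
      simp only [μ]
      rw [integral_withDensity_eq_integral_toReal_smul (by fun_prop) (by simp),
        ← integral_const_mul]
      refine setIntegral_congr_fun measurableSet_Ioo fun x hx => ?_
      have := hHpos x hx
      simp only [smul_eq_mul]
      rw [ENNReal.toReal_ofReal (by positivity), mul_assoc]
    have hμi : ∀ c, 0 < c → (Integrable (fun x => 1 - cos (l * x)) (μ c) ↔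
        IntegrableOn (fun x => H x * (1 - cos (l * x))) (Ioo 0 δ)) := by
      intro c hc
      simp only [μ]
      rw [integrable_withDensity_iff_integrable_smul' (by fun_prop) (by simp)]
      rw [IntegrableOn, ← integrable_const_mul_iff (c := c) (by simpa using hc.ne')
        (fun x => H x * (1 - cos (l * x)))]
      refine integrable_congr ?_
      filter_upwards [ae_restrict_mem measurableSet_Ioo] with x hx
      have := hHpos x hx
      simp only [smul_eq_mul]
      rw [ENNReal.toReal_ofReal (by positivity), mul_assoc]
    have hi1 : Integrable (fun x => 1 - cos (l * x)) (ν.restrict (Ioo 0 δ)) := (hint l).restrict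
    have hi2 := hi1.mono_measure hlow
    have hi3 := (hμi (1 + ε) (by linarith)).2 ((hμi (1 - ε) (by linarith)).1 hi2)
    rw [← hμint (1 - ε) (by linarith), ← hμint (1 + ε) (by linarith)]
    exact ⟨integral_mono_measure hlow (Eventually.of_forall (hg0 l)) hi1,
      integral_mono_measure hup (Eventually.of_forall (hg0 l)) hi3⟩
  have split : ∀ δ : ℝ, 0 < δ → ∀ l : ℝ,
      ∫ x in Ioo 0 δ, (1 - cos (l * x)) ∂ν ≤ ∫ x in Ioi 0, (1 - cos (l * x)) ∂ν ∧
      ∫ x in Ioi 0, (1 - cos (l * x)) ∂ν ≤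
        ∫ x in Ioo 0 δ, (1 - cos (l * x)) ∂ν + 2 * (ν (Ici δ)).toReal := by
    intro δ hδ l
    refine ⟨setIntegral_mono_set (hint l).integrableOn (Eventually.of_forall (hg0 l))
      (Eventually.of_forall Ioo_subset_Ioi_self), ?_⟩
    have hdis : Disjoint (Ioo 0 δ) (Ici δ) := (Set.disjoint_left).2
      fun x hx hx' => absurd hx.2 (not_lt.2 hx')
    rw [← Ioo_union_Ici_eq_Ioi hδ, setIntegral_union hdis measurableSet_Ici (hint l).integrableOn
      (hint l).integrableOn]
    gcongr
    have hf := measure_Ici_lt_top ν hνint δ hδ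
    calc _ ≤ ∫ x in Ici δ, (2:ℝ) ∂ν := by
          refine setIntegral_mono (hint l).integrableOn
            (integrableOn_const hf.ne) fun x => ?_
          have := neg_one_le_cos (l * x)
          simp only
          linarith
      _ = _ := by simp [Measure.real, mul_comm]
  have tl : Tendsto (fun l : ℝ => 1 / l) atTop (𝓝[>] 0) := by
    simpa using tendsto_inv_atTop_nhdsGT_zero (𝕜 := ℝ)
  have hNpos : ∀ᶠ l : ℝ in atTop, 0 < l ^ α * K (1 / l) := by
    filter_upwards [tl.eventually hK.2.1, eventually_gt_atTop 0] with l hl hl0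
    positivity
  rw [tendsto_order]
  constructor
  · intro a ha
    have : Tendsto (fun ε : ℝ => (1 - ε) * C) (𝓝[>] 0) (𝓝 C) := by
      have : ContinuousAt (fun ε : ℝ => (1 - ε) * C) 0 := by fun_prop
      simpa [ContinuousAt] using this.tendsto.mono_left nhdsWithin_le_nhds
    obtain ⟨ε, hεa, hε⟩ := ((this.eventually (lt_mem_nhds ha)).and
      (Ioo_mem_nhdsGT (zero_lt_one (α := ℝ)))).exists
    obtain ⟨δ, hδ, hδ', hb⟩ := main ε hε.1 hε.2
    filter_upwards [((hJ δ hδ hδ').const_mul (1 - ε)).eventually (lt_mem_nhds hεa), hNpos]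
      with l h1 h3
    refine h1.trans_le ?_
    rw [← mul_div_assoc]
    gcongr
    exact (hb l).1.trans (split δ hδ l).1
  · intro a ha
    have : Tendsto (fun ε : ℝ => (1 + ε) * C) (𝓝[>] 0) (𝓝 C) := by
      have : ContinuousAt (fun ε : ℝ => (1 + ε) * C) 0 := by fun_prop
      simpa [ContinuousAt] using this.tendsto.mono_left nhdsWithin_le_nhds
    obtain ⟨ε, hεa, hε⟩ := ((this.eventually (gt_mem_nhds ha)).and
      (Ioo_mem_nhdsGT (zero_lt_one (α := ℝ)))).exists
    obtain ⟨δ, hδ, hδ', hb⟩ := main ε hε.1 hε.2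
    have ht := ((hJ δ hδ hδ').const_mul (1 + ε)).add (hN.const_mul (2 * (ν (Ici δ)).toReal))
    rw [mul_zero, add_zero] at ht
    filter_upwards [ht.eventually (gt_mem_nhds hεa), hNpos] with l h1 h3
    refine lt_of_le_of_lt ?_ h1
    rw [← mul_div_assoc, mul_one_div, ← add_div]
    gcongr
    linarith [(hb l).2, (split δ hδ l).2]

theorem stmt6 (ν : Measure ℝ) (hν0 : ν {0} = 0)
    (hνint : ∫⁻ x, ENNReal.ofReal (min (x ^ 2) 1) ∂ν < ⊤)
    (ξ : ℝ → ℝ) (hξ : ν = MeasureTheory.volume.withDensity (fun x => ENNReal.ofReal (ξ x)))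
    (α : ℝ) (hα : α ∈ Set.Ioo (1:ℝ) 2)
    (Kp Km : ℝ → ℝ) (hKp : SlowlyVaryingAtZero Kp) (hKm : SlowlyVaryingAtZero Km)
    (hξp : Tendsto (fun x : ℝ => ξ x / (x ^ (-α - 1) * Kp x)) (𝓝[>] (0:ℝ)) (𝓝 1))
    (hξm : Tendsto (fun x : ℝ => ξ (-x) / (x ^ (-α - 1) * Km x)) (𝓝[>] (0:ℝ)) (𝓝 1))
    (k : ENNReal)
    (hk : Tendsto (fun x : ℝ => ENNReal.ofReal (Km x / Kp x)) (𝓝[>] (0:ℝ)) (𝓝 k))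
    (θ : ℝ → ℝ) (hθ : ∀ l : ℝ, θ l = ∫ x, (1 - Real.cos (l * x)) ∂ν) :
    Tendsto (fun l : ℝ => θ l / (l ^ α * (Kp (1 / l) + Km (1 / l)))) atTop
      (𝓝 (π * ((1 / π) * ∫ x in Set.Ioi (0:ℝ), (1 - Real.cos x) / x ^ (α + 1)))) := by
  rw [← mul_assoc, mul_one_div_cancel pi_ne_zero, one_mul]
  set C := ∫ x in Set.Ioi (0:ℝ), (1 - Real.cos x) / x ^ (α + 1) with hC
  have hA := one_sided ν hνint ξ hξ α hα.1 hα.2 Kp hKp hξp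
  have hB := one_sided (ν.map Neg.neg)
    (by
      rw [lintegral_map (by fun_prop) measurable_neg]
      simpa using hνint) (fun x => ξ (-x))
    (by
      ext s hs
      rw [Measure.map_apply measurable_neg hs, hξ, withDensity_apply _ (measurable_neg hs),
        withDensity_apply _ hs]
      have := (Measure.measurePreserving_neg (volume : Measure ℝ)).setLIntegral_comp_preimage_emb
        (MeasurableEquiv.neg ℝ).measurableEmbedding
        (fun x => ENNReal.ofReal (ξ (-x))) s
      simpa using this)
    α hα.1 hα.2 Km hKm hξm
  have hint := integrable_one_sub_cos ν hνint
  have hneg : ∀ l : ℝ, ∫ x in Ioi 0, (1 - Real.cos (l * x)) ∂(ν.map Neg.neg)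
      = ∫ x in Iio 0, (1 - Real.cos (l * x)) ∂ν := by
    intro l
    rw [setIntegral_map measurableSet_Ioi (by fun_prop) measurable_neg.aemeasurable]
    simp
  have hθs : ∀ l, θ l = ∫ x in Ioi 0, (1 - Real.cos (l * x)) ∂ν
      + ∫ x in Iio 0, (1 - Real.cos (l * x)) ∂ν := by
    intro l
    rw [hθ, ← integral_add_compl (measurableSet_Ioi (a := (0:ℝ))) (hint l), compl_Ioi]
    congr 1
    refine setIntegral_congr_set ?_
    rw [← Iio_union_right]
    exact (union_ae_eq_left_of_ae_eq_empty (ae_eq_empty.2 hν0))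
  simp only [hneg] at hB
  have tl : Tendsto (fun l : ℝ => 1 / l) atTop (𝓝[>] 0) := by
    simpa using tendsto_inv_atTop_nhdsGT_zero (𝕜 := ℝ)
  have hpos : ∀ᶠ l : ℝ in atTop, 0 < l ∧ 0 < Kp (1 / l) ∧ 0 < Km (1 / l) := by
    filter_upwards [tl.eventually hKp.2.1, tl.eventually hKm.2.1, eventually_gt_atTop 0]
      with l h1 h2 h3 using ⟨h3, h1, h2⟩
  rw [tendsto_order] at hA hB ⊢
  constructor
  · intro a ha
    filter_upwards [hA.1 a ha, hB.1 a ha, hpos] with l h1 h2 ⟨h3, h4, h5⟩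
    have := rpow_pos_of_pos h3 α
    rw [lt_div_iff₀ (by positivity)] at h1 h2 ⊢
    rw [hθs]; linarith
  · intro a ha
    filter_upwards [hA.2 a ha, hB.2 a ha, hpos] with l h1 h2 ⟨h3, h4, h5⟩
    have := rpow_pos_of_pos h3 α
    rw [div_lt_iff₀ (by positivity)] at h1 h2 ⊢
    rw [hθs]; linarith
end

section
/- Positive Gaussian case: suppose the Gaussian coefficient a > 0 and ∫₀^∞ |Im(λ/Ψ(λ))| dλ < ∞. Then the renormalized zero resolvent h(x) = (1/π)∫₀^∞ Re((1 - e^{iλx})/Ψ(λ)) dλ satisfies h(x) ~ c_± |x| as x → 0±, where c_± = 1/(2a) ± (1/π)∫₀^∞ Im(λ/Ψ(λ)) dλ. -/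
open MeasureTheory Set Filter Topology Real

lemma aux_tend {t : ℝ} (ht : 0 < t) : Tendsto (fun u : ℝ => exp (-(t * u))) atTop (𝓝 0) :=
  Real.tendsto_exp_neg_atTop_nhds_zero.comp (tendsto_id.const_mul_atTop ht)

lemma aux_one_sub_cos {t : ℝ} (ht : 0 < t) :
    ∫⁻ u in Ioi (0:ℝ), ENNReal.ofReal (t * (1 - cos u) * exp (-(t * u))) =
      ENNReal.ofReal ((1 + t ^ 2)⁻¹) := by
  have hd : ∀ x ∈ Ici (0:ℝ), HasDerivAt
      (fun u => - exp (-(t * u)) - t * (exp (-(t * u)) * (sin u - t * cos u)) / (1 + t ^ 2))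
      (t * (1 - cos x) * exp (-(t * x))) x := by
    intro x _
    have h1 : HasDerivAt (fun u => exp (-(t * u))) (exp (-(t * x)) * (-(t * 1))) x :=
      (((hasDerivAt_id x).const_mul t).neg).exp
    have h2 : HasDerivAt (fun u => sin u - t * cos u) (cos x - t * (- sin x)) x :=
      (hasDerivAt_sin x).sub ((hasDerivAt_cos x).const_mul t)
    refine (h1.neg.sub (((h1.mul h2).const_mul t).div_const (1 + t ^ 2))).congr_deriv ?_
    field_simp
    ring
  have hp : ∀ x ∈ Ioi (0:ℝ), 0 ≤ t * (1 - cos x) * exp (-(t * x)) := by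
    intro x _
    have := cos_le_one x
    have : 0 ≤ 1 - cos x := by linarith
    positivity
  have hl : Tendsto
      (fun u => - exp (-(t * u)) - t * (exp (-(t * u)) * (sin u - t * cos u)) / (1 + t ^ 2))
      atTop (𝓝 0) := by
    have h1 : Tendsto (fun u => exp (-(t * u)) * (sin u - t * cos u)) atTop (𝓝 0) := by
      refine squeeze_zero_norm (a := fun u => exp (-(t * u)) * (1 + t)) (fun u => ?_) ?_
      · rw [norm_mul, Real.norm_eq_abs, abs_exp]
        gcongr
        refine (norm_sub_le _ _).trans ?_
        rw [norm_mul, Real.norm_eq_abs, Real.norm_eq_abs, Real.norm_eq_abs, abs_of_pos ht]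
        have := abs_sin_le_one u
        have := abs_cos_le_one u
        nlinarith
      · simpa using (aux_tend ht).mul_const (1 + t)
    have := (aux_tend ht).neg.sub ((h1.const_mul t).div_const (1 + t ^ 2))
    simpa using this
  have hi := integrableOn_Ioi_deriv_of_nonneg' hd hp hl
  have he := integral_Ioi_of_hasDerivAt_of_nonneg' hd hp hl
  rw [← ofReal_integral_eq_lintegral_ofReal hi
    ((ae_restrict_iff' measurableSet_Ioi).2 (ae_of_all _ hp)), he]
  congr 1
  simp
  field_simp
  ring

lemma aux_exp {u : ℝ} (hu : 0 < u) :
    ∫⁻ t in Ioi (0:ℝ), ENNReal.ofReal (t * (1 - cos u) * exp (-(t * u))) =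
      ENNReal.ofReal ((1 - cos u) / u ^ 2) := by
  have hc : 0 ≤ 1 - cos u := by have := cos_le_one u; linarith
  have h := integral_rpow_mul_exp_neg_mul_Ioi (a := 2) (r := u) (by norm_num) hu
  have hi : IntegrableOn (fun t : ℝ => t ^ ((2:ℝ) - 1) * exp (-(u * t))) (Ioi 0) :=
    .of_integral_ne_zero (by rw [h]; positivity)
  have e : ∀ t : ℝ, t * (1 - cos u) * exp (-(t * u)) =
      (1 - cos u) * (t ^ ((2:ℝ) - 1) * exp (-(u * t))) := by
    intro t
    norm_num
    rw [mul_comm t u]; ring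
  simp_rw [e]
  rw [← ofReal_integral_eq_lintegral_ofReal (hi.const_mul _), integral_const_mul, h]
  · congr 1
    norm_num
    rfl
  · refine (ae_restrict_iff' measurableSet_Ioi).2 (ae_of_all _ fun t ht => ?_)
    have : (0:ℝ) < t := ht
    simp only [Pi.zero_apply]
    positivity

lemma aux_lint : ∫⁻ u in Ioi (0:ℝ), ENNReal.ofReal ((1 - cos u) / u ^ 2) =
    ENNReal.ofReal (π / 2) := by
  calc _ = ∫⁻ u in Ioi (0:ℝ), ∫⁻ t in Ioi (0:ℝ),
        ENNReal.ofReal (t * (1 - cos u) * exp (-(t * u))) :=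
        setLIntegral_congr_fun measurableSet_Ioi fun u hu => (aux_exp hu).symm
    _ = ∫⁻ t in Ioi (0:ℝ), ∫⁻ u in Ioi (0:ℝ),
        ENNReal.ofReal (t * (1 - cos u) * exp (-(t * u))) := by
        apply lintegral_lintegral_swap
        apply Measurable.aemeasurable
        unfold Function.uncurry
        fun_prop
    _ = ∫⁻ t in Ioi (0:ℝ), ENNReal.ofReal ((1 + t ^ 2)⁻¹) :=
        setLIntegral_congr_fun measurableSet_Ioi fun t ht => aux_one_sub_cos ht
    _ = _ := by
        rw [← ofReal_integral_eq_lintegral_ofReal integrable_inv_one_add_sq.integrableOn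
          (ae_of_all _ fun t => by simp only [Pi.zero_apply]; positivity),
          integral_Ioi_inv_one_add_sq]
        simp

lemma aux_nonneg (u : ℝ) : 0 ≤ (1 - cos u) / u ^ 2 := by
  have := cos_le_one u
  have : 0 ≤ 1 - cos u := by linarith
  positivity

lemma aux_integrable : IntegrableOn (fun u : ℝ => (1 - cos u) / u ^ 2) (Ioi 0) := by
  refine ⟨by apply Measurable.aestronglyMeasurable; fun_prop, ?_⟩
  rw [hasFiniteIntegral_iff_ofReal (ae_of_all _ aux_nonneg), aux_lint]
  exact ENNReal.ofReal_lt_top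

lemma aux_integral : ∫ u in Ioi (0:ℝ), (1 - cos u) / u ^ 2 = π / 2 := by
  rw [integral_eq_lintegral_of_nonneg_ae (ae_of_all _ aux_nonneg)
    aux_integrable.aestronglyMeasurable, aux_lint, ENNReal.toReal_ofReal (by positivity)]

/-- the Levy kernel -/
noncomputable def levyK (l x : ℝ) : ℂ := (1 : ℂ) - Complex.exp (Complex.I * (l * x))
            + Complex.I * (l * x) * (if |x| < 1 then 1 else 0)

lemma levyK_meas (l : ℝ) : Measurable (levyK l) := by
  unfold levyK
  have : Measurable (fun x : ℝ => if |x| < 1 then (1:ℂ) else 0) :=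
    Measurable.ite (measurableSet_lt (by fun_prop) (by fun_prop)) (by fun_prop) (by fun_prop)
  fun_prop

lemma levyK_cont (x : ℝ) : Continuous (fun l => levyK l x) := by
  unfold levyK
  fun_prop

lemma aux_norm1 (y : ℝ) : ‖(1:ℂ) - Complex.exp (Complex.I * y)‖ ≤ 2 := by
  refine (norm_sub_le _ _).trans ?_
  rw [Complex.norm_exp_I_mul_ofReal]
  norm_num

lemma aux_norm2 (y : ℝ) : ‖(1:ℂ) - Complex.exp (Complex.I * y) + Complex.I * y‖ ≤ 3 * y ^ 2 := by
  rcases le_or_gt |y| 1 with h | h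
  · have := Complex.norm_exp_sub_one_sub_id_le (x := Complex.I * y) (by simpa using h)
    rw [← norm_neg]
    have e : -((1:ℂ) - Complex.exp (Complex.I * y) + Complex.I * y) =
      Complex.exp (Complex.I * y) - 1 - Complex.I * y := by ring
    rw [e]
    refine this.trans ?_
    simp
    nlinarith [sq_nonneg y]
  · refine (norm_add_le _ _).trans ?_
    have := aux_norm1 y
    have e : ‖Complex.I * (y:ℂ)‖ = |y| := by simp
    rw [e, ← sq_abs y]
    nlinarith

lemma levyK_bound (l x : ℝ) : ‖levyK l x‖ ≤ (3 * l ^ 2 + 2) * min (x ^ 2) 1 := by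
  unfold levyK
  by_cases hx : |x| < 1
  · have h2 : x ^ 2 ≤ 1 := by rw [← sq_abs]; nlinarith [abs_nonneg x]
    have := aux_norm2 (l * x)
    rw [if_pos hx, min_eq_left h2, mul_one]
    push_cast at this
    refine this.trans ?_
    nlinarith [sq_nonneg x]
  · have h2 : 1 ≤ x ^ 2 := by rw [← sq_abs]; nlinarith [abs_nonneg x]
    have := aux_norm1 (l * x)
    rw [if_neg hx, min_eq_right h2, mul_zero, add_zero]
    push_cast at this
    refine this.trans ?_
    nlinarith [sq_nonneg l]

lemma levyK_re (l x : ℝ) : (levyK l x).re = 1 - cos (l * x) := by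
  unfold levyK
  have : Complex.I * ((l:ℂ) * x) = ((l * x : ℝ):ℂ) * Complex.I := by push_cast; ring
  rw [this]
  generalize l * x = y
  rw [Complex.exp_mul_I, ← Complex.ofReal_cos, ← Complex.ofReal_sin]
  split_ifs <;> simp [-Complex.ofReal_cos, -Complex.ofReal_sin]

lemma aux_minint {ν : Measure ℝ} (hνint : ∫⁻ x, ENNReal.ofReal (min (x ^ 2) 1) ∂ν < ⊤)
    : Integrable (fun x : ℝ => min (x ^ 2) 1) ν := by
  refine ⟨by apply Measurable.aestronglyMeasurable; fun_prop, ?_⟩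
  rwa [hasFiniteIntegral_iff_ofReal (ae_of_all _ fun x => by
    simp only [Pi.zero_apply]; positivity)]

lemma levyK_integrable {ν : Measure ℝ} (hνint : ∫⁻ x, ENNReal.ofReal (min (x ^ 2) 1) ∂ν < ⊤)
    (l : ℝ) : Integrable (levyK l) ν :=
  ((aux_minint hνint).const_mul (3 * l ^ 2 + 2)).mono' (levyK_meas l).aestronglyMeasurable
    (ae_of_all _ (levyK_bound l))

lemma levyK_int_cont {ν : Measure ℝ} (hνint : ∫⁻ x, ENNReal.ofReal (min (x ^ 2) 1) ∂ν < ⊤)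
    : Continuous (fun l => ∫ x, levyK l x ∂ν) := by
  rw [continuous_iff_continuousAt]
  intro l₀
  refine continuousAt_of_dominated (bound := fun x => (3 * (|l₀| + 1) ^ 2 + 2) * min (x ^ 2) 1)
    (Eventually.of_forall fun l => (levyK_meas l).aestronglyMeasurable) ?_
    ((aux_minint hνint).const_mul _) (ae_of_all _ fun x => (levyK_cont x).continuousAt)
  filter_upwards [Metric.ball_mem_nhds l₀ one_pos] with l hl
  refine ae_of_all _ fun x => (levyK_bound l x).trans ?_
  have : |l| ≤ |l₀| + 1 := by
    rw [Metric.mem_ball, Real.dist_eq] at hl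
    have := abs_sub_abs_le_abs_sub l l₀
    linarith
  rw [← sq_abs l]
  have : (0:ℝ) ≤ min (x ^ 2) 1 := by positivity
  gcongr

lemma levyK_int_re {ν : Measure ℝ} (hνint : ∫⁻ x, ENNReal.ofReal (min (x ^ 2) 1) ∂ν < ⊤)
    (l : ℝ) : 0 ≤ (∫ x, levyK l x ∂ν).re := by
  have := integral_re (𝕜 := ℂ) (levyK_integrable hνint l)
  simp only [RCLike.re_to_complex] at this
  rw [← this]
  refine integral_nonneg fun x => ?_
  simp only [levyK_re, Pi.zero_apply]
  have := cos_le_one (l * x)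
  linarith

lemma levyK_int_lim {ν : Measure ℝ} (hνint : ∫⁻ x, ENNReal.ofReal (min (x ^ 2) 1) ∂ν < ⊤)
    : Tendsto (fun l : ℝ => ((l ^ 2 : ℝ) : ℂ)⁻¹ * ∫ x, levyK l x ∂ν) atTop (𝓝 0) := by
  have e : (0:ℂ) = ∫ x : ℝ, (0:ℂ) ∂ν := by simp
  rw [e]
  simp_rw [← integral_const_mul]
  refine tendsto_integral_filter_of_dominated_convergence (fun x => 5 * min (x ^ 2) 1)
    (Eventually.of_forall fun l => ((levyK_meas l).const_mul _).aestronglyMeasurable) ?_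
    ((aux_minint hνint).const_mul _) (ae_of_all _ fun x => ?_)
  · filter_upwards [eventually_ge_atTop 1] with l hl
    refine ae_of_all _ fun x => ?_
    rw [norm_mul, norm_inv, Complex.norm_real, Real.norm_eq_abs, abs_of_nonneg (sq_nonneg l),
      inv_mul_le_iff₀ (by positivity)]
    refine (levyK_bound l x).trans ?_
    have : (0:ℝ) ≤ min (x ^ 2) 1 := by positivity
    rw [← mul_assoc]
    gcongr
    nlinarith
  · refine squeeze_zero_norm' (a := fun l : ℝ => 2 * (l⁻¹ * l⁻¹) + |x| * l⁻¹) ?_ ?_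
    · filter_upwards [eventually_gt_atTop 0] with l hl
      rw [norm_mul, norm_inv, Complex.norm_real, Real.norm_eq_abs, abs_of_nonneg (sq_nonneg l),
        inv_mul_le_iff₀ (by positivity)]
      have h1 : ‖levyK l x‖ ≤ 2 + l * |x| := by
        unfold levyK
        refine (norm_add_le _ _).trans ?_
        have := aux_norm1 (l * x)
        push_cast at this
        refine add_le_add this ?_
        split_ifs
        · simp [abs_of_pos hl]
        · simp; positivity
      refine h1.trans (le_of_eq ?_)
      field_simp
    · have := ((tendsto_inv_atTop_zero (𝕜 := ℝ)).mul tendsto_inv_atTop_zero).const_mul 2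
      simpa using this.add ((tendsto_inv_atTop_zero (𝕜 := ℝ)).const_mul |x|)


lemma main_half (a : ℝ) (ha : 0 < a) (Ψ : ℝ → ℂ) (hc : Continuous Ψ)
    (hre : ∀ l, a * l ^ 2 ≤ (Ψ l).re)
    (hlim : Tendsto (fun l : ℝ => ((l ^ 2 : ℝ) : ℂ)⁻¹ * Ψ l) atTop (𝓝 (a : ℂ)))
    (hint : IntegrableOn (fun l : ℝ => |((l : ℂ) / Ψ l).im|) (Set.Ioi 0))
    (s : ℝ) (hs : s = 1 ∨ s = -1) :
    Tendsto (fun r : ℝ => ((1 / π) * ∫ l in Set.Ioi (0:ℝ),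
        ((1 - Complex.exp (Complex.I * (l * (s * r : ℝ)))) / Ψ l).re) / r) (𝓝[>] (0:ℝ))
        (𝓝 (1 / (2 * a) + s * ((1 / π) * ∫ l in Set.Ioi (0:ℝ), ((l : ℂ) / Ψ l).im))) := by
  set F : ℝ → ℝ := fun l => (((l ^ 2 : ℝ) : ℂ) / Ψ l).re with hF
  set G : ℝ → ℝ := fun l => ((l : ℂ) / Ψ l).im with hG
  have hΨm : Measurable Ψ := hc.measurable
  have hFm : Measurable F := by
    have : Measurable (fun l : ℝ => ((l ^ 2 : ℝ) : ℂ) / Ψ l) := by fun_prop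
    exact Complex.measurable_re.comp this
  have hGm : Measurable G := by
    have : Measurable (fun l : ℝ => (l : ℂ) / Ψ l) := by fun_prop
    exact Complex.measurable_im.comp this
  have hGi : IntegrableOn G (Ioi 0) := by
    refine Integrable.mono' hint hGm.aestronglyMeasurable (ae_of_all _ fun l => le_rfl)
  have hFb : ∀ l, 0 < l → ‖F l‖ ≤ a⁻¹ := by
    intro l hl
    refine (Complex.abs_re_le_norm _).trans ?_
    have h1 : a * l ^ 2 ≤ ‖Ψ l‖ := (hre l).trans (Complex.re_le_norm _)
    have h2 : 0 < a * l ^ 2 := by positivity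
    rw [norm_div, Complex.norm_real, Real.norm_eq_abs, abs_of_nonneg (sq_nonneg l),
      div_le_iff₀ (h2.trans_le h1), ← div_eq_inv_mul, le_div_iff₀ ha]
    linarith
  have hFl : Tendsto F atTop (𝓝 a⁻¹) := by
    have h1 := hlim.inv₀ (by exact_mod_cast ha.ne')
    have h2 := (Complex.continuous_re.tendsto _).comp h1
    have e : ((a : ℂ)⁻¹).re = a⁻¹ := by rw [← Complex.ofReal_inv, Complex.ofReal_re]
    rw [e] at h2
    refine h2.congr fun l => ?_
    simp only [Function.comp, hF]
    congr 1
    rw [mul_inv, inv_inv, div_eq_mul_inv]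
  -- the decomposition
  have hdec : ∀ r, 0 < r → ∀ l ∈ Ioi (0:ℝ),
      ((1 - Complex.exp (Complex.I * (l * (s * r : ℝ)))) / Ψ l).re =
      (r ^ 2 * ((1 - cos (r * l)) / (r * l) ^ 2 * F (r⁻¹ * (r * l)))) + r * (s * (sin (r * l) / (r * l) * G l)) := by
    intro r hr l hl
    have hl' : (0:ℝ) < l := hl
    have e0 : r⁻¹ * (r * l) = l := by field_simp
    have e1 : Complex.I * ((l:ℂ) * (s * r : ℝ)) = ((s * (r * l) : ℝ) : ℂ) * Complex.I := by
      push_cast; ring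
    rw [e0, e1, Complex.exp_mul_I, ← Complex.ofReal_cos, ← Complex.ofReal_sin]
    have ec : cos (s * (r * l)) = cos (r * l) := by rcases hs with rfl | rfl <;> simp
    have es : sin (s * (r * l)) = s * sin (r * l) := by rcases hs with rfl | rfl <;> simp
    rw [ec, es]
    have hFe : F l = l ^ 2 * (1 / Ψ l).re := by
      simp only [hF]
      rw [← Complex.re_ofReal_mul]; congr 1; ring
    have hGe : G l = l * (1 / Ψ l).im := by
      simp only [hG]
      rw [← Complex.im_ofReal_mul]; congr 1; ring
    rw [hFe, hGe, div_eq_mul_one_div _ (Ψ l), Complex.mul_re]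
    generalize (1 / Ψ l) = z
    simp [-Complex.ofReal_cos, -Complex.ofReal_sin, -Complex.ofReal_mul]
    field_simp
    try ring
  have hI1 : ∀ r, 0 < r → IntegrableOn (fun u => (1 - cos u) / u ^ 2 * F (r⁻¹ * u)) (Ioi 0) := by
    intro r hr
    refine Integrable.mono' (aux_integrable.mul_const a⁻¹)
      (by apply Measurable.aestronglyMeasurable; fun_prop) ?_
    refine (ae_restrict_iff' measurableSet_Ioi).2 (ae_of_all _ fun u hu => ?_)
    have hu' : (0:ℝ) < u := hu
    rw [norm_mul, Real.norm_eq_abs ((1 - cos u) / u ^ 2), abs_of_nonneg (aux_nonneg u)]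
    exact mul_le_mul_of_nonneg_left (hFb _ (by positivity)) (aux_nonneg u)
  have hsb : ∀ y : ℝ, |sin y / y| ≤ 1 := by
    intro y
    rw [abs_div]
    exact div_le_one_of_le₀ abs_sin_le_abs (abs_nonneg _)
  have hb2 : ∀ r l : ℝ, ‖sin (r * l) / (r * l) * G l‖ ≤ |G l| := by
    intro r l
    rw [norm_mul, Real.norm_eq_abs, Real.norm_eq_abs]
    exact mul_le_of_le_one_left (abs_nonneg _) (hsb _)
  have hI2 : ∀ r : ℝ, IntegrableOn (fun l => sin (r * l) / (r * l) * G l) (Ioi 0) := by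
    intro r
    exact Integrable.mono' hint (by apply Measurable.aestronglyMeasurable; fun_prop)
      (ae_of_all _ (hb2 r))
  have hval : ∀ r, 0 < r → ((1 / π) * ∫ l in Set.Ioi (0:ℝ),
        ((1 - Complex.exp (Complex.I * (l * (s * r : ℝ)))) / Ψ l).re) / r =
      (1 / π) * (∫ u in Ioi (0:ℝ), (1 - cos u) / u ^ 2 * F (r⁻¹ * u)) +
      s * ((1 / π) * ∫ l in Ioi (0:ℝ), sin (r * l) / (r * l) * G l) := by
    intro r hr
    have hI1' : IntegrableOn (fun l => (1 - cos (r * l)) / (r * l) ^ 2 * F (r⁻¹ * (r * l)))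
        (Ioi 0) := by
      have := (integrableOn_Ioi_comp_mul_left_iff
        (fun u => (1 - cos u) / u ^ 2 * F (r⁻¹ * u)) 0 hr).2 (by simpa using hI1 r hr)
      exact this
    rw [setIntegral_congr_fun measurableSet_Ioi (hdec r hr),
      integral_add (hI1'.const_mul _) (((hI2 r).const_mul s).const_mul r),
      integral_const_mul, integral_const_mul, integral_const_mul,
      integral_comp_mul_left_Ioi (fun u => (1 - cos u) / u ^ 2 * F (r⁻¹ * u)) 0 hr]
    simp only [mul_zero, smul_eq_mul]
    field_simp
  have hT1 : Tendsto (fun r : ℝ => ∫ u in Ioi (0:ℝ), (1 - cos u) / u ^ 2 * F (r⁻¹ * u))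
      (𝓝[>] 0) (𝓝 (∫ u in Ioi (0:ℝ), (1 - cos u) / u ^ 2 * a⁻¹)) := by
    refine tendsto_integral_filter_of_dominated_convergence
      (fun u => (1 - cos u) / u ^ 2 * a⁻¹) ?_ ?_ (aux_integrable.mul_const a⁻¹) ?_
    · exact Eventually.of_forall fun r => by
        apply Measurable.aestronglyMeasurable; fun_prop
    · filter_upwards [self_mem_nhdsWithin] with r hr
      have hr' : (0:ℝ) < r := hr
      refine (ae_restrict_iff' measurableSet_Ioi).2 (ae_of_all _ fun u hu => ?_)
      have hu' : (0:ℝ) < u := hu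
      rw [norm_mul, Real.norm_eq_abs ((1 - cos u) / u ^ 2), abs_of_nonneg (aux_nonneg u)]
      exact mul_le_mul_of_nonneg_left (hFb _ (by positivity)) (aux_nonneg u)
    · refine (ae_restrict_iff' measurableSet_Ioi).2 (ae_of_all _ fun u hu => ?_)
      exact (hFl.comp (tendsto_inv_nhdsGT_zero.atTop_mul_const hu)).const_mul _
  have hT2 : Tendsto (fun r : ℝ => ∫ l in Ioi (0:ℝ), sin (r * l) / (r * l) * G l)
      (𝓝[>] 0) (𝓝 (∫ l in Ioi (0:ℝ), G l)) := by
    refine tendsto_integral_filter_of_dominated_convergence (fun l => |G l|) ?_ ?_ hint ?_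
    · exact Eventually.of_forall fun r => by
        apply Measurable.aestronglyMeasurable; fun_prop
    · exact Eventually.of_forall fun r => ae_of_all _ (hb2 r)
    · refine (ae_restrict_iff' measurableSet_Ioi).2 (ae_of_all _ fun l hl => ?_)
      have hl' : (0:ℝ) < l := hl
      have h1 : Tendsto (fun r : ℝ => sinc (r * l)) (𝓝[>] 0) (𝓝 1) := by
        have : Continuous (fun r : ℝ => sinc (r * l)) := continuous_sinc.comp (by fun_prop)
        have := this.tendsto 0
        simp only [zero_mul, sinc_zero] at this
        exact this.mono_left nhdsWithin_le_nhds
      have h2 := h1.mul_const (G l)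
      rw [one_mul] at h2
      refine h2.congr' ?_
      filter_upwards [self_mem_nhdsWithin] with r hr
      have hr' : (0:ℝ) < r := hr
      rw [sinc_of_ne_zero (by positivity)]
  have hT := (hT1.const_mul (1 / π)).add ((hT2.const_mul (1 / π)).const_mul s)
  have e : (1 / π) * ∫ u in Ioi (0:ℝ), (1 - cos u) / u ^ 2 * a⁻¹ = 1 / (2 * a) := by
    rw [integral_mul_const, aux_integral]
    have := Real.pi_pos
    field_simp
  rw [e] at hT
  refine hT.congr' ?_
  filter_upwards [self_mem_nhdsWithin] with r hr
  exact (hval r hr).symm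

theorem stmt15 (a b : ℝ) (ha : 0 < a) (ν : Measure ℝ) (hν0 : ν {0} = 0)
    (hνint : ∫⁻ x, ENNReal.ofReal (min (x ^ 2) 1) ∂ν < ⊤)
    (Ψ : ℝ → ℂ)
    (hΨ : ∀ l : ℝ, Ψ l = ((a * l ^ 2 : ℝ) : ℂ) + Complex.I * ((b * l : ℝ) : ℂ)
        + ∫ x, ((1 : ℂ) - Complex.exp (Complex.I * (l * x))
            + Complex.I * (l * x) * (if |x| < 1 then 1 else 0)) ∂ν)
    (hint : IntegrableOn (fun l : ℝ => |((l : ℂ) / Ψ l).im|) (Set.Ioi 0))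
    (h : ℝ → ℝ)
    (hh : ∀ x : ℝ, h x =
        (1 / π) * ∫ l in Set.Ioi (0:ℝ), ((1 - Complex.exp (Complex.I * (l * x))) / Ψ l).re) :
    Tendsto (fun x : ℝ => h x / |x|) (𝓝[>] (0:ℝ))
        (𝓝 (1 / (2 * a) + (1 / π) * ∫ l in Set.Ioi (0:ℝ), ((l : ℂ) / Ψ l).im))
    ∧ Tendsto (fun x : ℝ => h x / |x|) (𝓝[<] (0:ℝ))
        (𝓝 (1 / (2 * a) - (1 / π) * ∫ l in Set.Ioi (0:ℝ), ((l : ℂ) / Ψ l).im)) := by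
  have hΨ' : ∀ l : ℝ, Ψ l = ((a * l ^ 2 : ℝ) : ℂ) + Complex.I * ((b * l : ℝ) : ℂ)
        + ∫ x, levyK l x ∂ν := hΨ
  have hc : Continuous Ψ := by
    rw [show Ψ = _ from funext hΨ']
    have := levyK_int_cont hνint
    fun_prop
  have hre : ∀ l, a * l ^ 2 ≤ (Ψ l).re := by
    intro l
    rw [hΨ' l, Complex.add_re, Complex.add_re, Complex.ofReal_re, Complex.I_mul_re,
      Complex.ofReal_im]
    have := levyK_int_re hνint l
    linarith
  have hlim : Tendsto (fun l : ℝ => ((l ^ 2 : ℝ) : ℂ)⁻¹ * Ψ l) atTop (𝓝 (a : ℂ)) := by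
    have h1 : Tendsto (fun l : ℝ => ((l⁻¹ : ℝ) : ℂ)) atTop (𝓝 ((0:ℝ):ℂ)) :=
      (Complex.continuous_ofReal.tendsto _).comp tendsto_inv_atTop_zero
    have h2 := ((h1.const_mul (Complex.I * b)).const_add (a:ℂ)).add (levyK_int_lim hνint)
    simp only [Complex.ofReal_zero, mul_zero, add_zero] at h2
    refine h2.congr' ?_
    filter_upwards [eventually_gt_atTop 0] with l hl
    have : (l:ℂ) ≠ 0 := by exact_mod_cast hl.ne'
    rw [hΨ' l]
    push_cast
    field_simp
  have key := main_half a ha Ψ hc hre hlim hint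
  constructor
  · have k := key 1 (Or.inl rfl)
    rw [one_mul] at k
    refine k.congr' ?_
    filter_upwards [self_mem_nhdsWithin] with r hr
    rw [hh r, abs_of_pos hr, one_mul]
  · have k := key (-1) (Or.inr rfl)
    rw [neg_one_mul, ← sub_eq_add_neg] at k
    have hn : Tendsto (fun x : ℝ => -x) (𝓝[<] 0) (𝓝[>] 0) := by
      simpa using tendsto_neg_nhdsLT (a := (0:ℝ))
    refine (k.comp hn).congr' ?_
    filter_upwards [self_mem_nhdsWithin] with r hr
    simp only [Function.comp]
    rw [hh r, abs_of_neg hr]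
    simp only [neg_mul, one_mul, neg_neg]
end

section
/- Strictly stable case: for a strictly stable Lévy process of index α ∈ (1,2) with θ(λ) = c_θ λ^α and ω(λ) = c_ω λ^α for λ > 0 (c_θ > 0, c_ω ∈ ℝ), the function h given by h(x) = (1/π)∫₀^∞ Re((1 - e^{iλx})/Ψ(λ)) dλ equals c_± |x|^{α-1} exactly for ±x > 0, where c_± = (C_α/(c_θ² + c_ω²))(c_θ ± c_ω cot(πα/2)) and C_α = (1/π)∫₀^∞(1-cos u)/u^α du. -/
open MeasureTheory Set Filter Topology Real

theorem bnd (u : ℝ) : ‖1 - Complex.exp (Complex.I * u)‖ ≤ min |u| 2 := by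
  apply le_min
  · rw [norm_sub_rev]; exact Real.norm_exp_I_mul_ofReal_sub_one_le
  · refine (norm_sub_le _ _).trans ?_
    rw [mul_comm, Complex.norm_exp_ofReal_mul_I]; norm_num

theorem bndInt (α : ℝ) (h1 : 1 < α) (h2 : α < 2) :
    IntegrableOn (fun u : ℝ => min |u| 2 * u ^ (-α)) (Ioi 0) := by
  have hm : Measurable (fun u : ℝ => min |u| 2 * u ^ (-α)) := by fun_prop
  rw [← Ioc_union_Ioi_eq_Ioi (zero_le_one (α := ℝ)), integrableOn_union]
  constructor
  · have h : IntegrableOn (fun u : ℝ => u ^ (1 - α)) (Ioc 0 1) :=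
      (intervalIntegrable_iff_integrableOn_Ioc_of_le zero_le_one).1
        (intervalIntegral.intervalIntegrable_rpow' (by linarith))
    refine Integrable.mono' h hm.aestronglyMeasurable ?_
    refine (ae_restrict_iff' measurableSet_Ioc).2 (Eventually.of_forall fun u hu => ?_)
    have hp : 0 < u ^ (-α) := rpow_pos_of_pos hu.1 _
    rw [Real.norm_of_nonneg (by positivity), sub_eq_add_neg, rpow_add hu.1, rpow_one]
    gcongr
    exact (min_le_left _ _).trans (abs_of_pos hu.1).le
  · have h : IntegrableOn (fun u : ℝ => 2 * u ^ (-α)) (Ioi 1) :=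
      (integrableOn_Ioi_rpow_of_lt (by linarith) one_pos).const_mul 2
    refine Integrable.mono' h hm.aestronglyMeasurable ?_
    refine (ae_restrict_iff' measurableSet_Ioi).2 (Eventually.of_forall fun u hu => ?_)
    have hu0 : (0:ℝ) < u := lt_trans one_pos hu
    have hp : 0 < u ^ (-α) := rpow_pos_of_pos hu0 _
    rw [Real.norm_of_nonneg (by positivity)]
    gcongr
    exact min_le_right _ _

theorem fnorm (α ε u : ℝ) (hε : 0 ≤ ε) (hu : 0 < u) :
    ‖Complex.exp (-(ε * u : ℂ)) * (1 - Complex.exp (Complex.I * u)) * ((u ^ (-α) : ℝ) : ℂ)‖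
      ≤ min |u| 2 * u ^ (-α) := by
  have hp : 0 < u ^ (-α) := rpow_pos_of_pos hu _
  rw [norm_mul, norm_mul, Complex.norm_real, Real.norm_of_nonneg hp.le]
  gcongr
  have : ‖Complex.exp (-(ε * u : ℂ))‖ ≤ 1 := by
    rw [Complex.norm_exp]
    simp
    positivity
  calc _ ≤ 1 * ‖1 - Complex.exp (Complex.I * u)‖ := by gcongr
    _ ≤ _ := by rw [one_mul]; exact bnd u

theorem fInt (α ε : ℝ) (h1 : 1 < α) (h2 : α < 2) (hε : 0 ≤ ε) :
    IntegrableOn (fun u : ℝ => Complex.exp (-(ε * u : ℂ)) * (1 - Complex.exp (Complex.I * u)) *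
      ((u ^ (-α) : ℝ) : ℂ)) (Ioi 0) := by
  refine Integrable.mono' (bndInt α h1 h2) (Measurable.aestronglyMeasurable (by fun_prop)) ?_
  exact (ae_restrict_iff' measurableSet_Ioi).2 (Eventually.of_forall fun u hu => fnorm α ε u hε hu)

theorem gInt (α : ℝ) (s : ℂ) (h2 : α < 2) (hs : 0 < s.re) :
    IntegrableOn (fun u : ℝ => Complex.exp (-(s * u)) * ((u ^ (1-α) : ℝ) : ℂ)) (Ioi 0) := by
  have := integrableOn_rpow_mul_exp_neg_mul_rpow (p := 1) (s := 1 - α) (by linarith) one_pos hs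
  refine Integrable.mono' this (Measurable.aestronglyMeasurable (by fun_prop)) ?_
  refine (ae_restrict_iff' measurableSet_Ioi).2 (Eventually.of_forall fun u hu => ?_)
  rw [norm_mul, Complex.norm_real, Real.norm_of_nonneg (rpow_nonneg (le_of_lt hu) _), Complex.norm_exp]
  simp [mul_comm]

theorem gDiff (α : ℝ) (s : ℂ) (h2 : α < 2) (hs : 0 < s.re) :
    DifferentiableAt ℂ (fun s : ℂ => ∫ u in Ioi (0:ℝ), Complex.exp (-(s * u)) * ((u ^ (1-α) : ℝ) : ℂ)) s := by
  have hb : IntegrableOn (fun u : ℝ => u ^ (2-α) * Real.exp (-(s.re/2) * u ^ (1:ℝ))) (Ioi 0) :=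
    integrableOn_rpow_mul_exp_neg_mul_rpow (by linarith) one_pos (by linarith)
  have := hasDerivAt_integral_of_dominated_loc_of_deriv_le (𝕜 := ℂ) (μ := volume.restrict (Ioi (0:ℝ)))
    (F := fun (s : ℂ) (u : ℝ) => Complex.exp (-(s * u)) * ((u ^ (1-α) : ℝ) : ℂ))
    (F' := fun (s : ℂ) (u : ℝ) => Complex.exp (-(s * u)) * (-(1 * u)) * ((u ^ (1-α) : ℝ) : ℂ))
    (x₀ := s) (s := {z | s.re / 2 < z.re})
    (bound := fun u : ℝ => u ^ (2-α) * Real.exp (-(s.re/2) * u ^ (1:ℝ)))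
    ((isOpen_lt continuous_const Complex.continuous_re).mem_nhds (by simpa using hs))
    (Eventually.of_forall fun z => Measurable.aestronglyMeasurable (by fun_prop))
    (gInt α s h2 hs) (Measurable.aestronglyMeasurable (by fun_prop))
    ((ae_restrict_iff' measurableSet_Ioi).2 (Eventually.of_forall fun u hu z hz => ?_)) hb
    (Eventually.of_forall fun u z hz => ?_)
  · exact this.2.differentiableAt
  · have hu : (0:ℝ) < u := hu
    have hz : s.re / 2 < z.re := hz
    rw [norm_mul, norm_mul, Complex.norm_real, Real.norm_of_nonneg (rpow_nonneg hu.le _),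
      Complex.norm_exp, norm_neg, one_mul, Complex.norm_real, Real.norm_of_nonneg hu.le,
      show 2 - α = 1 + (1 - α) by ring, rpow_add hu, rpow_one, mul_assoc, mul_comm]
    have hp : 0 < u ^ (1-α) := rpow_pos_of_pos hu _
    gcongr
    simp
    nlinarith
  · exact ((((hasDerivAt_id z).mul_const (u:ℂ)).neg).cexp).mul_const _

theorem gVal (α : ℝ) (s : ℂ) (h2 : α < 2) (hs : 0 < s.re) :
    ∫ u in Ioi (0:ℝ), Complex.exp (-(s * u)) * ((u ^ (1-α) : ℝ) : ℂ)
      = (1 / s) ^ (2 - α : ℂ) * Complex.Gamma (2 - α) := by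
  have ho : IsOpen {z : ℂ | 0 < z.re} := isOpen_lt continuous_const Complex.continuous_re
  have a1 : AnalyticOnNhd ℂ (fun s : ℂ => ∫ u in Ioi (0:ℝ), Complex.exp (-(s * u)) *
      ((u ^ (1-α) : ℝ) : ℂ)) {z : ℂ | 0 < z.re} :=
    DifferentiableOn.analyticOnNhd (fun z hz => (gDiff α z h2 hz).differentiableWithinAt) ho
  have a2 : AnalyticOnNhd ℂ (fun s : ℂ => (1 / s) ^ (2 - α : ℂ) * Complex.Gamma (2 - α))
      {z : ℂ | 0 < z.re} := by
    refine DifferentiableOn.analyticOnNhd (fun z hz => DifferentiableAt.differentiableWithinAt ?_) ho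
    have hz : 0 < z.re := hz
    have hz0 : z ≠ 0 := by rintro rfl; simp at hz
    refine DifferentiableAt.mul_const (DifferentiableAt.cpow_const ?_ ?_) _
    · exact (differentiableAt_const _).div differentiableAt_id hz0
    · left
      rw [one_div, Complex.inv_re]
      exact div_pos hz (Complex.normSq_pos.2 hz0)
  refine AnalyticOnNhd.eqOn_of_preconnected_of_frequently_eq a1 a2
    (convex_halfSpace_re_gt 0).isPreconnected (z₀ := 1) (by simp) ?_ hs
  have ht : Tendsto (fun r : ℝ => (r:ℂ)) (𝓝[>] 1) (𝓝[≠] 1) := by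
    refine tendsto_nhdsWithin_iff.2 ⟨?_, ?_⟩
    · have := (Complex.continuous_ofReal.tendsto 1)
      simp only [Complex.ofReal_one] at this
      exact this.mono_left nhdsWithin_le_nhds
    · filter_upwards [self_mem_nhdsWithin] with r hr
      have hr : 1 < r := hr
      simpa using hr.ne'
  refine ht.frequently (Eventually.frequently ?_)
  filter_upwards [self_mem_nhdsWithin] with r hr
  have hr : 1 < r := hr
  rw [← Complex.integral_cpow_mul_exp_neg_mul_Ioi (by simpa using h2) (by linarith)]
  refine setIntegral_congr_fun measurableSet_Ioi fun u hu => ?_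
  beta_reduce
  rw [Complex.ofReal_cpow (le_of_lt hu), mul_comm]
  push_cast
  ring_nf

theorem ibp (α ε : ℝ) (h1 : 1 < α) (h2 : α < 2) (hε : 0 < ε) :
    (α - 1 : ℂ) * ∫ u in Ioi (0:ℝ), Complex.exp (-(ε * u : ℂ)) * (1 - Complex.exp (Complex.I * u)) *
      ((u ^ (-α) : ℝ) : ℂ) =
    ((ε - Complex.I) * (1 / (ε - Complex.I)) ^ (2 - α : ℂ) - ε * (1 / (ε:ℂ)) ^ (2 - α : ℂ))
      * Complex.Gamma (2 - α) := by
  have i1 := fInt α ε h1 h2 hε.le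
  have i2 := gInt α (ε - Complex.I) h2 (by simpa using hε)
  have i3 := gInt α ε h2 (by simpa using hε)
  have key := integral_Ioi_of_hasDerivAt_of_tendsto (a := 0) (m := 0)
    (f := fun u : ℝ => Complex.exp (-(ε * u : ℂ)) * (1 - Complex.exp (Complex.I * u)) *
      ((u ^ (1-α) : ℝ) : ℂ))
    (f' := fun u : ℝ => ((ε - Complex.I) * (Complex.exp (-((ε - Complex.I) * u)) * ((u ^ (1-α) : ℝ) : ℂ))
      - ε * (Complex.exp (-(ε * u : ℂ)) * ((u ^ (1-α) : ℝ) : ℂ)))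
      - (α - 1 : ℂ) * (Complex.exp (-(ε * u : ℂ)) * (1 - Complex.exp (Complex.I * u)) *
      ((u ^ (-α) : ℝ) : ℂ))) ?_ ?_ ?_ ?_
  · rw [integral_sub (by exact (i2.const_mul _).sub (i3.const_mul _)) (i1.const_mul _),
      integral_sub (i2.const_mul _) (i3.const_mul _), integral_const_mul, integral_const_mul,
      integral_const_mul, gVal α _ h2 (by simpa using hε), gVal α _ h2 (by simpa using hε)] at key
    simp at key
    simp
    linear_combination -key
  · -- continuity at 0
    have hz : ((0:ℝ) ^ (1 - α)) = 0 := zero_rpow (by linarith)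
    rw [ContinuousWithinAt, hz]
    simp only [Complex.ofReal_zero, mul_zero]
    rw [← Ioi_insert, nhdsWithin_insert, tendsto_sup]
    constructor
    · have := tendsto_pure_nhds (fun u : ℝ => Complex.exp (-(ε * u : ℂ)) *
        (1 - Complex.exp (Complex.I * u)) * ((u ^ (1-α) : ℝ) : ℂ)) 0
      simpa [hz] using this
    · have : Tendsto (fun u : ℝ => u ^ (2 - α)) (𝓝[>] 0) (𝓝 0) := by
        have := (Real.continuousAt_rpow_const 0 (2 - α) (Or.inr (by linarith))).tendsto
        rw [zero_rpow (by linarith)] at this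
        exact this.mono_left nhdsWithin_le_nhds
      refine squeeze_zero_norm' ?_ this
      filter_upwards [self_mem_nhdsWithin] with u hu
      have := fnorm (α-1) ε u hε.le hu
      rw [show -(α - 1) = 1 - α by ring] at this
      refine this.trans ?_
      rw [show 2 - α = 1 + (1 - α) by ring, rpow_add hu, rpow_one]
      have hp : 0 < u ^ (1-α) := rpow_pos_of_pos hu _
      gcongr
      exact (min_le_left _ _).trans (abs_of_pos hu).le
  · intro u hu
    have hu : (0:ℝ) < u := hu
    have d1 : HasDerivAt (fun u : ℝ => Complex.exp (-(ε * u : ℂ)))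
        (Complex.exp (-(ε * u : ℂ)) * (-(ε * 1))) u :=
      (((Complex.ofRealCLM.hasDerivAt (x := u)).const_mul (ε:ℂ)).neg).cexp
    have d2 : HasDerivAt (fun u : ℝ => 1 - Complex.exp (Complex.I * u))
        (-(Complex.exp (Complex.I * u) * (Complex.I * 1))) u :=
      (((Complex.ofRealCLM.hasDerivAt (x := u)).const_mul Complex.I).cexp).const_sub 1
    have d3 := (Real.hasDerivAt_rpow_const (x := u) (p := 1 - α) (Or.inl hu.ne')).ofReal_comp
    refine ((d1.mul d2).mul d3).congr_deriv ?_
    simp only [Pi.mul_apply]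
    have e : Complex.exp (-((ε - Complex.I) * u)) = Complex.exp (-(ε * u : ℂ)) * Complex.exp (Complex.I * u) := by
      rw [← Complex.exp_add]; ring_nf
    rw [e, show 1 - α - 1 = -α by ring]
    push_cast
    ring
  · exact ((i2.const_mul _).sub (i3.const_mul _)).sub (i1.const_mul _)
  · have : Tendsto (fun u : ℝ => 2 * u ^ (-(α-1))) atTop (𝓝 (2 * 0)) :=
      (tendsto_rpow_neg_atTop (by linarith)).const_mul 2
    rw [mul_zero] at this
    refine squeeze_zero_norm' ?_ this
    filter_upwards [eventually_gt_atTop 0] with u hu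
    have := fnorm (α-1) ε u hε.le hu
    have e : -(α - 1) = 1 - α := by ring
    have hp : 0 < u ^ (1-α) := rpow_pos_of_pos hu _
    rw [e] at this ⊢
    refine this.trans ?_
    gcongr
    exact min_le_right _ _

theorem lim (α : ℝ) (h1 : 1 < α) (h2 : α < 2) :
    (α - 1 : ℂ) * ∫ u in Ioi (0:ℝ), (1 - Complex.exp (Complex.I * u)) * ((u ^ (-α) : ℝ) : ℂ) =
    ((- Complex.I) * (1 / (- Complex.I)) ^ (2 - α : ℂ)) * Complex.Gamma (2 - α) := by
  have L : Tendsto (fun ε : ℝ => (α - 1 : ℂ) * ∫ u in Ioi (0:ℝ), Complex.exp (-(ε * u : ℂ)) *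
      (1 - Complex.exp (Complex.I * u)) * ((u ^ (-α) : ℝ) : ℂ)) (𝓝[>] 0)
      (𝓝 ((α - 1 : ℂ) * ∫ u in Ioi (0:ℝ), (1 - Complex.exp (Complex.I * u)) * ((u ^ (-α) : ℝ) : ℂ))) := by
    refine Tendsto.const_mul _ ?_
    refine tendsto_integral_filter_of_dominated_convergence (fun u : ℝ => min |u| 2 * u ^ (-α)) ?_ ?_
      (bndInt α h1 h2) ?_
    · exact Eventually.of_forall fun ε => Measurable.aestronglyMeasurable (by fun_prop)
    · filter_upwards [self_mem_nhdsWithin] with ε hε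
      exact (ae_restrict_iff' measurableSet_Ioi).2 (Eventually.of_forall fun u hu =>
        fnorm α ε u (le_of_lt hε) hu)
    · refine Eventually.of_forall fun u => ?_
      have : Continuous (fun ε : ℝ => Complex.exp (-(ε * u : ℂ)) *
        (1 - Complex.exp (Complex.I * u)) * ((u ^ (-α) : ℝ) : ℂ)) := by fun_prop
      have := this.tendsto 0
      simp only [Complex.ofReal_zero, zero_mul, neg_zero, Complex.exp_zero, one_mul] at this
      exact this.mono_left nhdsWithin_le_nhds
  refine tendsto_nhds_unique_of_eventuallyEq L (g := fun ε : ℝ =>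
    ((ε - Complex.I) * (1 / (ε - Complex.I)) ^ (2 - α : ℂ) - ε * (1 / (ε:ℂ)) ^ (2 - α : ℂ))
      * Complex.Gamma (2 - α)) ?_ ?_
  · refine Tendsto.mul_const _ ?_
    rw [← sub_zero (-Complex.I * _)]
    refine Tendsto.sub ?_ ?_
    · have : ContinuousAt (fun ε : ℝ => (ε - Complex.I) * (1 / (ε - Complex.I)) ^ (2 - α : ℂ)) 0 := by
        have hc : ContinuousAt (fun ε : ℝ => (ε:ℂ) - Complex.I) 0 := by fun_prop
        refine hc.mul (ContinuousAt.cpow (continuousAt_const.div hc (by simp)) continuousAt_const ?_)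
        simp [Complex.slitPlane]
      have := this.tendsto
      simp only [Complex.ofReal_zero, zero_sub] at this
      exact this.mono_left nhdsWithin_le_nhds
    · have : Tendsto (fun ε : ℝ => ((ε ^ (α-1) : ℝ) : ℂ)) (𝓝[>] 0) (𝓝 0) := by
        have := (Real.continuousAt_rpow_const 0 (α-1) (Or.inr (by linarith))).tendsto
        rw [zero_rpow (by linarith)] at this
        rw [← Complex.ofReal_zero]
        exact (Complex.continuous_ofReal.tendsto _).comp (this.mono_left nhdsWithin_le_nhds)
      refine this.congr' ?_
      filter_upwards [self_mem_nhdsWithin] with ε hε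
      have hε : 0 < ε := hε
      have : ε ^ (α - 1) = ε * (1/ε) ^ (2 - α) := by
        rw [one_div, inv_rpow hε.le, ← rpow_neg hε.le, ← rpow_one_add' hε.le (by linarith)]
        ring_nf
      rw [this]
      push_cast
      rw [Complex.ofReal_cpow (by positivity)]
      push_cast; rfl
  · filter_upwards [self_mem_nhdsWithin] with ε hε
    exact ibp α ε h1 h2 hε

theorem val (α : ℝ) (h1 : 1 < α) (h2 : α < 2) : ∃ K : ℝ,
    ∫ u in Ioi (0:ℝ), (1 - Complex.exp (Complex.I * u)) * ((u ^ (-α) : ℝ) : ℂ) =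
    ((K * Real.sin (π * α / 2) : ℝ) : ℂ) + Complex.I * ((K * Real.cos (π * α / 2) : ℝ):ℂ) := by
  refine ⟨Real.Gamma (2 - α) / (α - 1), ?_⟩
  have := lim α h1 h2
  have hne : (α - 1 : ℂ) ≠ 0 := by
    exact_mod_cast (by linarith : α - 1 ≠ 0)
  apply mul_left_cancel₀ hne
  rw [this]
  have e1 : (1 / (-Complex.I)) ^ (2 - α : ℂ) = Complex.exp ((π * (2-α) / 2 : ℝ) * Complex.I) := by
    rw [one_div, inv_neg, Complex.inv_I, neg_neg, Complex.cpow_def_of_ne_zero Complex.I_ne_zero,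
      Complex.log_I]
    push_cast; ring_nf
  have e2 : π * (2-α) / 2 = π - π * α / 2 := by ring
  rw [e1, Complex.exp_mul_I, ← Complex.ofReal_cos, ← Complex.ofReal_sin, e2, Real.cos_pi_sub,
    Real.sin_pi_sub, show (2 - α : ℂ) = ((2 - α : ℝ) : ℂ) by push_cast; rfl, Complex.Gamma_ofReal]
  push_cast
  field_simp
  linear_combination (- Complex.sin (π * α / 2)) * (Real.Gamma (2-α) : ℂ) * Complex.I_sq

theorem core (α p q x : ℝ) (h1 : 1 < α) (h2 : α < 2) (hx : 0 < x) :
    ∫ l in Ioi (0:ℝ), (p * (1 - Real.cos (l * x)) - q * Real.sin (l * x)) / l ^ α =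
    (∫ u in Ioi (0:ℝ), (1 - Real.cos u) / u ^ α) *
      (p + q * (Real.cos (π * α / 2) / Real.sin (π * α / 2))) * x ^ (α - 1) := by
  obtain ⟨K, hK⟩ := val α h1 h2
  have hi : IntegrableOn (fun u : ℝ => (1 - Complex.exp (Complex.I * u)) * ((u ^ (-α) : ℝ) : ℂ))
      (Ioi 0) := by
    simpa using fInt α 0 h1 h2 le_rfl
  have hsin : 0 < Real.sin (π * α / 2) := by
    apply Real.sin_pos_of_pos_of_lt_pi
    · have := Real.pi_pos; positivity
    · nlinarith [Real.pi_pos]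
  have er : ∀ u : ℝ, ((1 - Complex.exp (Complex.I * u)) * ((u ^ (-α) : ℝ) : ℂ)).re =
      (1 - Real.cos u) * u ^ (-α) := by
    intro u
    rw [Complex.re_mul_ofReal, mul_comm Complex.I, Complex.exp_mul_I]
    simp [Complex.cos_ofReal_re]
  have ei : ∀ u : ℝ, ((1 - Complex.exp (Complex.I * u)) * ((u ^ (-α) : ℝ) : ℂ)).im =
      - (Real.sin u * u ^ (-α)) := by
    intro u
    rw [Complex.im_mul_ofReal, mul_comm Complex.I, Complex.exp_mul_I]
    simp [Complex.sin_ofReal_re]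
  have iA : IntegrableOn (fun u : ℝ => (1 - Real.cos u) * u ^ (-α)) (Ioi 0) := by
    have := hi.re
    simp only [RCLike.re_to_complex, er] at this
    exact this
  have iS : IntegrableOn (fun u : ℝ => Real.sin u * u ^ (-α)) (Ioi 0) := by
    have := hi.im.neg
    simp only [RCLike.im_to_complex, ei] at this
    refine this.congr (Eventually.of_forall fun u => ?_)
    simp
  have vA : ∫ u in Ioi (0:ℝ), (1 - Real.cos u) * u ^ (-α) = K * Real.sin (π * α / 2) := by
    have := integral_re hi
    simp only [RCLike.re_to_complex, er] at this
    rw [this, hK]; simp [-Complex.ofReal_mul, -Complex.ofReal_sin, -Complex.ofReal_cos]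
  have vS : ∫ u in Ioi (0:ℝ), Real.sin u * u ^ (-α) = - (K * Real.cos (π * α / 2)) := by
    have := integral_im hi
    simp only [RCLike.im_to_complex, ei] at this
    rw [integral_neg, hK] at this
    simp [-Complex.ofReal_mul, -Complex.ofReal_sin, -Complex.ofReal_cos] at this
    linarith
  have vA' : ∫ u in Ioi (0:ℝ), (1 - Real.cos u) / u ^ α = K * Real.sin (π * α / 2) := by
    rw [← vA]
    refine setIntegral_congr_fun measurableSet_Ioi fun u hu => ?_
    beta_reduce
    rw [rpow_neg (le_of_lt hu), div_eq_mul_inv]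
  have sc := integral_comp_mul_right_Ioi (fun u : ℝ => p * ((1 - Real.cos u) * u ^ (-α)) -
    q * (Real.sin u * u ^ (-α))) 0 hx
  rw [zero_mul, integral_sub (iA.const_mul p) (iS.const_mul q), integral_const_mul,
    integral_const_mul, vA, vS] at sc
  have e : ∫ l in Ioi (0:ℝ), (p * (1 - Real.cos (l * x)) - q * Real.sin (l * x)) / l ^ α =
      x ^ α * ∫ l in Ioi (0:ℝ), (p * ((1 - Real.cos (l * x)) * (l * x) ^ (-α)) -
    q * (Real.sin (l * x) * (l * x) ^ (-α))) := by
    rw [← integral_const_mul]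
    refine setIntegral_congr_fun measurableSet_Ioi fun u hu => ?_
    have hu : (0:ℝ) < u := hu
    beta_reduce
    rw [mul_rpow hu.le hx.le, rpow_neg hu.le, rpow_neg hx.le]
    have := (rpow_pos_of_pos hx α).ne'
    field_simp
  rw [e, sc, vA', rpow_sub_one hx.ne', smul_eq_mul]
  field_simp
  ring

theorem stmt19 (α cθ cω : ℝ) (hα : α ∈ Set.Ioo (1:ℝ) 2) (hcθ : 0 < cθ)
    (Ψ : ℝ → ℂ)
    (hΨ : ∀ l : ℝ, 0 < l →
        Ψ l = ((cθ * l ^ α : ℝ) : ℂ) + Complex.I * ((cω * l ^ α : ℝ) : ℂ))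
    (h : ℝ → ℝ)
    (hh : ∀ x : ℝ, h x =
        (1 / π) * ∫ l in Set.Ioi (0:ℝ), ((1 - Complex.exp (Complex.I * (l * x))) / Ψ l).re) :
    (∀ x : ℝ, 0 < x →
        h x = (((1 / π) * ∫ u in Set.Ioi (0:ℝ), (1 - Real.cos u) / u ^ α)
              / (cθ ^ 2 + cω ^ 2))
            * (cθ + cω * (Real.cos (π * α / 2) / Real.sin (π * α / 2))) * x ^ (α - 1))
    ∧ (∀ x : ℝ, x < 0 →
        h x = (((1 / π) * ∫ u in Set.Ioi (0:ℝ), (1 - Real.cos u) / u ^ α)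
              / (cθ ^ 2 + cω ^ 2))
            * (cθ - cω * (Real.cos (π * α / 2) / Real.sin (π * α / 2))) * |x| ^ (α - 1)) := by
  obtain ⟨h1, h2⟩ := hα
  have hD : 0 < cθ ^ 2 + cω ^ 2 := by positivity
  have main : ∀ x : ℝ, h x = (1 / π) * ((1 / (cθ ^ 2 + cω ^ 2)) * ∫ l in Ioi (0:ℝ),
      (cθ * (1 - Real.cos (l * x)) - cω * Real.sin (l * x)) / l ^ α) := by
    intro x
    rw [hh]
    congr 1
    rw [← integral_const_mul]
    refine setIntegral_congr_fun measurableSet_Ioi fun l hl => ?_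
    have hl : (0:ℝ) < l := hl
    have hp := rpow_pos_of_pos hl α
    beta_reduce
    have e1 : Complex.exp (Complex.I * (l * x)) =
        (Real.cos (l * x) : ℂ) + (Real.sin (l * x) : ℂ) * Complex.I := by
      rw [mul_comm, ← Complex.ofReal_mul, Complex.exp_mul_I, Complex.ofReal_cos, Complex.ofReal_sin]
    rw [hΨ l hl, e1, Complex.div_re, Complex.normSq_apply]
    simp only [Complex.add_re, Complex.add_im, Complex.sub_re, Complex.sub_im, Complex.mul_re,
      Complex.mul_im, Complex.ofReal_re, Complex.ofReal_im, Complex.I_re, Complex.I_im,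
      Complex.one_re, Complex.one_im]
    have h3 : cθ * l ^ α * (cθ * l ^ α) + cω * l ^ α * (cω * l ^ α) ≠ 0 := by
      have : cθ * l ^ α * (cθ * l ^ α) + cω * l ^ α * (cω * l ^ α) =
        (cθ ^ 2 + cω ^ 2) * (l ^ α * l ^ α) := by ring
      rw [this]; positivity
    ring_nf at h3 ⊢
    field_simp
  refine ⟨fun x hx => ?_, fun x hx => ?_⟩
  · rw [main, core α cθ cω x h1 h2 hx]
    ring
  · have := core α cθ (-cω) (-x) h1 h2 (by linarith)
    simp only [mul_neg, Real.cos_neg, Real.sin_neg, neg_mul, neg_neg] at this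
    rw [main, this, abs_of_neg hx]
    ring
end
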